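/- arXiv:1502.00693 — 2 statements merged into one kernel-verified Lean document; each statement's English description precedes it below -/
import Mathlib

section
/- Let P be a heptagonal typical 7-configuration with points p₀,…,p₆ numbered consecutively along the cyclic order coming from convex position (indices modulo 7). If d(p_i) ∉ {0, 6}, then d_{i−1,i} ≠ d_{i,i+1}. -/
open scoped LinearAlgebra.Projectivization
open Projectivization

noncomputable section

/-- The real projective plane: the projectivization of `ℝ³`. -/
abbrev RP2 := ℙ ℝ (Fin 3 → ℝ)

/-- The quotient topology on the real projective plane. -/
instance : TopologicalSpace RP2 :=
  inferInstanceAs (TopologicalSpace (Quotient (projectivizationSetoid ℝ (Fin 3 → ℝ))))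

/-- Three points of `ℙ²(ℝ)` are collinear if they admit linearly dependent representatives. -/
def Collin (a b c : RP2) : Prop :=
  ¬ LinearIndependent ℝ ![a.rep, b.rep, c.rep]

/-- The conic (zero set in `ℙ²(ℝ)`) associated to a quadratic form on `ℝ³`. -/
def ConicSet (q : QuadraticForm ℝ (Fin 3 → ℝ)) : Set RP2 := {p : RP2 | q p.rep = 0}

/-- A set of points is coconic if some conic contains all of them. -/
def Coconic (s : Set RP2) : Prop :=
  ∃ q : QuadraticForm ℝ (Fin 3 → ℝ), q ≠ 0 ∧ ∀ p ∈ s, q p.rep = 0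

/-- A labeled `n`-configuration is simple if it is injective and has no collinear triple. -/
def SimpleCfg {n : ℕ} (f : Fin n → RP2) : Prop :=
  Function.Injective f ∧
    ∀ i j k : Fin n, i ≠ j → i ≠ k → j ≠ k → ¬ Collin (f i) (f j) (f k)

/-- A labeled `n`-configuration is typical if it is simple and no six of its points are coconic. -/
def TypicalCfg {n : ℕ} (f : Fin n → RP2) : Prop :=
  SimpleCfg f ∧ ∀ g : Fin 6 → Fin n, Function.Injective g → ¬ Coconic (Set.range (f ∘ g))

/-- A projective line: the set of points whose representatives lie in a 2-dimensional
subspace of `ℝ³`. -/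
def IsProjLine (L : Set RP2) : Prop :=
  ∃ W : Submodule ℝ (Fin 3 → ℝ), Module.finrank ℝ W = 2 ∧ L = {p : RP2 | p.rep ∈ W}

/-- `p` lies inside the conic of `q` if every projective line through `p` meets the conic. -/
def InsideConic (q : QuadraticForm ℝ (Fin 3 → ℝ)) (p : RP2) : Prop :=
  ∀ L : Set RP2, IsProjLine L → p ∈ L → (L ∩ ConicSet q).Nonempty

/-- `p` lies outside the conic of `q` if some projective line through `p` misses the conic. -/
def OutsideConic (q : QuadraticForm ℝ (Fin 3 → ℝ)) (p : RP2) : Prop :=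
  ∃ L : Set RP2, IsProjLine L ∧ p ∈ L ∧ L ∩ ConicSet q = ∅

/-- A point `f i` of a configuration is dominant if it lies outside every conic passing
through all the other points of the configuration. -/
def Dominant {n : ℕ} (f : Fin n → RP2) (i : Fin n) : Prop :=
  ∀ q : QuadraticForm ℝ (Fin 3 → ℝ), q ≠ 0 → (∀ j, j ≠ i → q ((f j).rep) = 0) →
    OutsideConic q (f i)

/-- A point `f i` of a configuration is subdominant if it lies inside every conic passing
through all the other points of the configuration. -/
def Subdominant {n : ℕ} (f : Fin n → RP2) (i : Fin n) : Prop :=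
  ∀ q : QuadraticForm ℝ (Fin 3 → ℝ), q ≠ 0 → (∀ j, j ≠ i → q ((f j).rep) = 0) →
    InsideConic q (f i)

/-- The affine chart determined by a nonzero linear functional `φ` (with `L∞ = {φ = 0}`):
a point off `L∞` is sent to its representative rescaled to lie on the affine plane `φ = 1`. -/
def chart (φ : (Fin 3 → ℝ) →ₗ[ℝ] ℝ) (p : RP2) : Fin 3 → ℝ := (φ p.rep)⁻¹ • p.rep

/-- Convex position with respect to the affine chart of `φ`: the line `{φ = 0}` misses the
configuration, and in the chart every point lies outside the convex hull of the others. -/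
def ConvexPosWith {n : ℕ} (φ : (Fin 3 → ℝ) →ₗ[ℝ] ℝ) (f : Fin n → RP2) : Prop :=
  φ ≠ 0 ∧ (∀ i, φ (f i).rep ≠ 0) ∧
    ∀ i, chart φ (f i) ∉ convexHull ℝ (chart φ '' (f '' {j | j ≠ i}))

/-- A configuration is in convex position if it is so in some affine chart. -/
def ConvexPos {n : ℕ} (f : Fin n → RP2) : Prop := ∃ φ, ConvexPosWith φ f

/-- The labeling of a configuration is consecutive for the convex position in the chart of `φ`:
each pair `f i`, `f (i+1)` (cyclically) spans an edge of the convex polygon, i.e. is cut out by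
an affine functional which is strictly larger on both of them than on all the other points. -/
def ConsecWith {n : ℕ} [NeZero n] (φ : (Fin 3 → ℝ) →ₗ[ℝ] ℝ) (f : Fin n → RP2) : Prop :=
  ConvexPosWith φ f ∧
    ∀ i : Fin n, ∃ ψ : (Fin 3 → ℝ) →ₗ[ℝ] ℝ,
      ψ (chart φ (f i)) = ψ (chart φ (f (i + 1))) ∧
      ∀ j : Fin n, j ≠ i → j ≠ i + 1 → ψ (chart φ (f j)) < ψ (chart φ (f i))

/-- A configuration is in convex position with consecutive cyclic labeling. -/
def ConsecConvexPos {n : ℕ} [NeZero n] (f : Fin n → RP2) : Prop := ∃ φ, ConsecWith φ f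

/-- A Q-deformation (an `n`-tuple of continuous paths through typical configurations). -/
def QDeformFam (n : ℕ) (γ : Fin n → unitInterval → RP2) : Prop :=
  (∀ i, Continuous (γ i)) ∧ ∀ t : unitInterval, TypicalCfg (fun i => γ i t)

end
noncomputable section

/-- `f i` lies outside every conic through the five points of the 7-configuration other
than `f i` and `f j`. -/
def OutAll (f : Fin 7 → RP2) (i j : Fin 7) : Prop :=
  ∀ q : QuadraticForm ℝ (Fin 3 → ℝ), q ≠ 0 → (∀ k, k ≠ i → k ≠ j → q ((f k).rep) = 0) →
    OutsideConic q (f i)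

open Classical in
/-- `d_{i,j}` equals 1 if `f i` lies outside every conic through the five remaining points,
and 0 otherwise (i.e. if it lies inside every such conic). -/
def dIdx (f : Fin 7 → RP2) (i j : Fin 7) : ℕ :=
  if OutAll f i j then 1 else 0

/-- The dominance index `d(p_i) = Σ_{j ≠ i} d_{i,j}`. -/
def domIdx (f : Fin 7 → RP2) (i : Fin 7) : ℕ :=
  ∑ j ∈ Finset.univ.erase i, dIdx f i j

/-- The determinant of the matrix with rows `a`, `b`, `c`. -/
def br (a b c : Fin 3 → ℝ) : ℝ := Matrix.det (Matrix.of ![a, b, c])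

theorem br_eq (a b c : Fin 3 → ℝ) : br a b c =
    a 0 * (b 1 * c 2 - b 2 * c 1) - a 1 * (b 0 * c 2 - b 2 * c 0) +
      a 2 * (b 0 * c 1 - b 1 * c 0) := by
  simp [br, Matrix.det_fin_three]; ring

/-- The values at `x` of the six monomials of degree two. -/
def veronese (x : Fin 3 → ℝ) : Fin 6 → ℝ :=
  ![x 0 ^ 2, x 1 ^ 2, x 2 ^ 2, x 0 * x 1, x 0 * x 2, x 1 * x 2]

section Laplace

open Matrix

theorem det_of_vecCons {n : ℕ} (a : Fin (n + 1) → ℝ) (M : Fin n → Fin (n + 1) → ℝ) :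
    (of (vecCons a M)).det =
      ∑ k : Fin (n + 1), (-1) ^ (k : ℕ) * a k * (of fun i j => M i (k.succAbove j)).det := by
  rw [det_succ_row_zero]; rfl

theorem vecCons_apply_succAbove {m n : ℕ} (k : Fin (n + 1)) (a : Fin (n + 1) → ℝ)
    (M : Fin m → Fin (n + 1) → ℝ) :
    (fun i j => (vecCons a M) i (k.succAbove j)) =
      vecCons (k.removeNth a) (fun i j => M i (k.succAbove j)) := by
  ext i j; exact Fin.cases rfl (fun _ => rfl) i

theorem vecEmpty_apply_succAbove {n : ℕ} (k : Fin (n + 1)) :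
    (fun (i : Fin 0) j => (![] : Fin 0 → Fin (n + 1) → ℝ) i (k.succAbove j)) = ![] := by
  ext i j; exact i.elim0

theorem removeNth_zero_vecCons {n : ℕ} (a : ℝ) (v : Fin n → ℝ) :
    Fin.removeNth 0 (vecCons a v) = v := rfl

theorem removeNth_succ_vecCons {n : ℕ} (a : ℝ) (v : Fin (n + 1) → ℝ) (k : Fin (n + 1)) :
    Fin.removeNth k.succ (vecCons a v) = vecCons a (Fin.removeNth k v) := by
  ext i; exact Fin.cases rfl (fun j => by simp [Fin.removeNth]) i

set_option maxHeartbeats 4000000 in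
set_option maxRecDepth 10000 in
theorem det_veronese (a b c d e f : Fin 3 → ℝ) :
    (of ![veronese a, veronese b, veronese c, veronese d, veronese e, veronese f]).det =
      br b c d * br b e f * br c e a * br d f a - br b c e * br b d f * br c d a * br e f a := by
  simp only [br_eq, veronese]
  generalize a 0 = a0, a 1 = a1, a 2 = a2, b 0 = b0, b 1 = b1, b 2 = b2
  generalize c 0 = c0, c 1 = c1, c 2 = c2, d 0 = d0, d 1 = d1, d 2 = d2
  generalize e 0 = e0, e 1 = e1, e 2 = e2, f 0 = f0, f 1 = f1, f 2 = f2
  simp only [det_of_vecCons, vecCons_apply_succAbove, vecEmpty_apply_succAbove,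
    Fin.sum_univ_succ, removeNth_zero_vecCons, removeNth_succ_vecCons, cons_val_zero,
    cons_val_succ, det_fin_zero, Fin.val_succ, Fin.val_zero, Finset.univ_eq_empty,
    Finset.sum_empty]
  simp only [zero_add, pow_zero, pow_succ, one_mul, mul_one, add_zero, neg_mul, mul_neg, neg_neg]
  ring

end Laplace

theorem br_cycle (a b c : Fin 3 → ℝ) : br b c a = br a b c := by
  simp only [br_eq]; ring

theorem br_swap (a b c : Fin 3 → ℝ) : br a c b = -br a b c := by
  simp only [br_eq]; ring

theorem br_self_left (a b : Fin 3 → ℝ) : br a b a = 0 := by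
  simp only [br_eq]; ring

theorem br_self_right (a b : Fin 3 → ℝ) : br a b b = 0 := by
  simp only [br_eq]; ring

theorem br_smul (r s t : ℝ) (a b c : Fin 3 → ℝ) :
    br (r • a) (s • b) (t • c) = r * s * t * br a b c := by
  simp only [br_eq, Pi.smul_apply, smul_eq_mul]; ring

/-- Cramer's rule in `ℝ³`. -/
theorem br_smul_eq (a b c x : Fin 3 → ℝ) :
    br a b c • x = br x b c • a + br a x c • b + br a b x • c := by
  ext i
  simp only [br_eq, Pi.add_apply, Pi.smul_apply, smul_eq_mul]
  fin_cases i <;> simp <;> ring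

theorem exists_coord {a b c : Fin 3 → ℝ} (h : br a b c ≠ 0) (x : Fin 3 → ℝ) :
    ∃ X Y Z : ℝ, x = X • a + Y • b + Z • c := by
  refine ⟨(br a b c)⁻¹ * br x b c, (br a b c)⁻¹ * br a x c, (br a b c)⁻¹ * br a b x, ?_⟩
  simp only [mul_smul, ← smul_add]
  rw [← br_smul_eq, smul_smul, inv_mul_cancel₀ h, one_smul]

/-- The three-term Grassmann–Plücker relation. -/
theorem br_pluecker (a b c d e : Fin 3 → ℝ) :
    br a b c * br a d e - br a b d * br a c e + br a b e * br a c d = 0 := by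
  simp only [br_eq]; ring

/-- The linear form `x ↦ br a b x`, vanishing on the line spanned by `a` and `b`. -/
def brForm (a b : Fin 3 → ℝ) : (Fin 3 → ℝ) →ₗ[ℝ] ℝ where
  toFun := br a b
  map_add' x y := by simp only [br_eq, Pi.add_apply]; ring
  map_smul' r x := by simp only [br_eq, Pi.smul_apply, smul_eq_mul, RingHom.id_apply]; ring

@[simp]
theorem brForm_apply (a b x : Fin 3 → ℝ) : brForm a b x = br a b x := rfl

theorem quadraticForm_lincomb (q : QuadraticForm ℝ (Fin 3 → ℝ)) (a b c : Fin 3 → ℝ) (X Y Z : ℝ) :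
    q (X • a + Y • b + Z • c) = X ^ 2 * q a + Y ^ 2 * q b + Z ^ 2 * q c +
      X * Y * QuadraticMap.polar q a b + X * Z * QuadraticMap.polar q a c +
      Y * Z * QuadraticMap.polar q b c := by
  simp only [QuadraticMap.map_add q, QuadraticMap.map_smul, QuadraticMap.polar_add_left,
    QuadraticMap.polar_smul_left, QuadraticMap.polar_smul_right, smul_eq_mul]
  ring

/-- The determinant whose vanishing expresses that six points lie on a conic. -/
def conicDet (x : Fin 6 → Fin 3 → ℝ) : ℝ := Matrix.det (Matrix.of fun i => veronese (x i))

theorem conicDet_eq (x : Fin 6 → Fin 3 → ℝ) : conicDet x =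
    br (x 1) (x 2) (x 3) * br (x 1) (x 4) (x 5) * br (x 2) (x 4) (x 0) * br (x 3) (x 5) (x 0) -
      br (x 1) (x 2) (x 4) * br (x 1) (x 3) (x 5) * br (x 2) (x 3) (x 0) * br (x 4) (x 5) (x 0) := by
  rw [← det_veronese, conicDet]
  congr 2
  ext i : 1
  fin_cases i <;> rfl

theorem exists_veronese_coeff (q : QuadraticForm ℝ (Fin 3 → ℝ)) :
    ∃ c : Fin 6 → ℝ, ∀ x, q x = ∑ k, veronese x k * c k := by
  let e : Fin 3 → Fin 3 → ℝ := fun i => Pi.single i 1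
  refine ⟨![q (e 0), q (e 1), q (e 2), QuadraticMap.polar q (e 0) (e 1),
    QuadraticMap.polar q (e 0) (e 2), QuadraticMap.polar q (e 1) (e 2)], fun x => ?_⟩
  have hx : x = x 0 • e 0 + x 1 • e 1 + x 2 • e 2 := by
    ext i; fin_cases i <;> simp [e]
  conv_lhs => rw [hx, quadraticForm_lincomb]
  simp [Fin.sum_univ_succ, veronese]
  ring

theorem exists_quadraticForm_of_coeff {c : Fin 6 → ℝ} (hc : c ≠ 0) :
    ∃ q : QuadraticForm ℝ (Fin 3 → ℝ), q ≠ 0 ∧ ∀ x, q x = ∑ k, veronese x k * c k := by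
  let l : Fin 3 → ((Fin 3 → ℝ) →ₗ[ℝ] ℝ) := LinearMap.proj
  let m := fun i j => QuadraticMap.linMulLin (l i) (l j)
  let q := c 0 • m 0 0 + c 1 • m 1 1 + c 2 • m 2 2 + c 3 • m 0 1 + c 4 • m 0 2 + c 5 • m 1 2
  have hq : ∀ x, q x = ∑ k, veronese x k * c k := fun x => by
    simp [q, m, l, Fin.sum_univ_succ, veronese]
    ring
  refine ⟨q, fun h => hc ?_, hq⟩
  have hz : ∀ x, ∑ k, veronese x k * c k = 0 := fun x => by rw [← hq, h]; rfl
  have h0 := hz ![1, 0, 0]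
  have h1 := hz ![0, 1, 0]
  have h2 := hz ![0, 0, 1]
  have h3 := hz ![1, 1, 0]
  have h4 := hz ![1, 0, 1]
  have h5 := hz ![0, 1, 1]
  simp [Fin.sum_univ_succ, veronese] at h0 h1 h2 h3 h4 h5
  ext k
  fin_cases k <;> simp <;> linarith

theorem eq_zero_of_conicDet_ne_zero {x : Fin 6 → Fin 3 → ℝ} (hx : conicDet x ≠ 0)
    {q : QuadraticForm ℝ (Fin 3 → ℝ)} (hq : ∀ i, q (x i) = 0) : q = 0 := by
  obtain ⟨c, hc⟩ := exists_veronese_coeff q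
  have h0 : c = 0 := by
    refine Matrix.eq_zero_of_mulVec_eq_zero hx (funext fun i => ?_)
    exact (hc (x i)).symm.trans (hq i)
  ext y
  simp [hc, h0]

theorem exists_quadraticForm_of_conicDet_eq_zero {x : Fin 6 → Fin 3 → ℝ} (hx : conicDet x = 0) :
    ∃ q : QuadraticForm ℝ (Fin 3 → ℝ), q ≠ 0 ∧ ∀ i, q (x i) = 0 := by
  obtain ⟨c, hc, h⟩ := Matrix.exists_mulVec_eq_zero_iff.mpr hx
  obtain ⟨q, hq, hqc⟩ := exists_quadraticForm_of_coeff hc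
  exact ⟨q, hq, fun i => (hqc _).trans (congrFun h i)⟩

/-- The linear dependence between the values of a quadratic form at seven points. -/
theorem sum_conicDet_mul (y : Fin 7 → Fin 3 → ℝ) (q : QuadraticForm ℝ (Fin 3 → ℝ)) :
    ∑ j : Fin 7, (-1) ^ (j : ℕ) * q (y j) * conicDet (y ∘ j.succAbove) = 0 := by
  obtain ⟨c, hc⟩ := exists_veronese_coeff q
  let M : Matrix (Fin 7) (Fin 7) ℝ := Matrix.of fun j => Fin.cons (q (y j)) (veronese (y j))
  have hM : M.det = 0 := by
    refine Matrix.exists_mulVec_eq_zero_iff.mp ⟨Fin.cons (-1) c, fun h => ?_, ?_⟩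
    · simpa using congrFun h 0
    · ext j
      simp [M, Matrix.mulVec, dotProduct, Fin.sum_univ_succ (n := 6), hc (y j)]
  rw [Matrix.det_succ_column_zero] at hM
  exact hM

section Conic

variable {q : QuadraticForm ℝ (Fin 3 → ℝ)} {a b c : Fin 3 → ℝ}

/-- In suitably scaled coordinates, a conic through the three coordinate points is the zero set
of `XY + YZ + XZ`. -/
theorem exists_coord_of_isotropic (habc : br a b c ≠ 0) (ha : q a = 0) (hb : q b = 0)
    (hc : q c = 0)
    (hk : QuadraticMap.polar q a b * QuadraticMap.polar q b c * QuadraticMap.polar q a c ≠ 0) :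
    ∃ u v w : Fin 3 → ℝ, (∀ x, ∃ X Y Z : ℝ, x = X • u + Y • v + Z • w) ∧
      ∀ X Y Z : ℝ, q (X • u + Y • v + Z • w) =
        QuadraticMap.polar q a b * QuadraticMap.polar q b c * QuadraticMap.polar q a c *
          (X * Y + Y * Z + X * Z) := by
  set r := QuadraticMap.polar q a b
  set s := QuadraticMap.polar q b c
  set t := QuadraticMap.polar q a c
  have hr : r ≠ 0 := fun h => hk (by simp [h])
  have hs : s ≠ 0 := fun h => hk (by simp [h])
  have ht : t ≠ 0 := fun h => hk (by simp [h])
  refine ⟨s • a, t • b, r • c, fun x => exists_coord ?_ x, fun X Y Z => ?_⟩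
  · rw [br_smul]
    exact mul_ne_zero (mul_ne_zero (mul_ne_zero hs ht) hr) habc
  · simp only [smul_smul, quadraticForm_lincomb, ha, hb, hc]
    change _ + _ * r + _ * t + _ * s = _
    ring

theorem outsideConic_of_neg (habc : br a b c ≠ 0) (ha : q a = 0) (hb : q b = 0) (hc : q c = 0)
    {p : RP2} (h : q p.rep * (QuadraticMap.polar q a b * QuadraticMap.polar q b c *
      QuadraticMap.polar q a c) < 0) : OutsideConic q p := by
  set k := QuadraticMap.polar q a b * QuadraticMap.polar q b c * QuadraticMap.polar q a c with hkdef
  have hk : k ≠ 0 := fun h0 => by simp [h0] at h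
  obtain ⟨u, v, w, hspan, hq⟩ := exists_coord_of_isotropic habc ha hb hc hk
  obtain ⟨X, Y, Z, hp⟩ := hspan p.rep
  have hneg : X * Y + Y * Z + X * Z < 0 := by
    rw [hp, hq, ← hkdef] at h
    have : 0 < k ^ 2 := by positivity
    nlinarith
  set d := (Y - Z) • u + (Z - X) • v + (X - Y) • w
  have hval : ∀ α β : ℝ, q (α • p.rep + β • d) = k * (α ^ 2 * (X * Y + Y * Z + X * Z) -
      β ^ 2 * (((Y - Z) ^ 2 + (Z - X) ^ 2 + (X - Y) ^ 2) / 2)) := fun α β => by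
    have : α • p.rep + β • d = (α * X + β * (Y - Z)) • u + (α * Y + β * (Z - X)) • v +
        (α * Z + β * (X - Y)) • w := by
      rw [hp]; module
    rw [this, hq, ← hkdef]
    ring
  have hpos : 0 < ((Y - Z) ^ 2 + (Z - X) ^ 2 + (X - Y) ^ 2) / 2 := by
    nlinarith [sq_nonneg X, sq_nonneg Y, sq_nonneg Z]
  have hdef : ∀ α β : ℝ, q (α • p.rep + β • d) = 0 → α = 0 ∧ β = 0 := fun α β h0 => by
    rw [hval] at h0
    have h1 := (mul_eq_zero.mp h0).resolve_left hk
    have h2 : 0 ≤ α ^ 2 * -(X * Y + Y * Z + X * Z) := mul_nonneg (sq_nonneg _) (by linarith)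
    have h3 := mul_nonneg (sq_nonneg β) hpos.le
    have h4 : α ^ 2 * (X * Y + Y * Z + X * Z) = 0 := by linarith
    have h5 : β ^ 2 * (((Y - Z) ^ 2 + (Z - X) ^ 2 + (X - Y) ^ 2) / 2) = 0 := by linarith
    exact ⟨by simpa [hneg.ne] using h4, pow_eq_zero_iff two_ne_zero |>.mp
      ((mul_eq_zero.mp h5).resolve_right hpos.ne')⟩
  have hli : LinearIndependent ℝ ![p.rep, d] :=
    LinearIndependent.pair_iff.mpr fun α β h0 => hdef α β (by rw [h0, QuadraticMap.map_zero])
  refine ⟨_, ⟨Submodule.span ℝ (Set.range ![p.rep, d]), ?_, rfl⟩, ?_, ?_⟩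
  · simpa using finrank_span_eq_card hli
  · exact Submodule.subset_span ⟨0, rfl⟩
  · refine Set.eq_empty_of_forall_notMem fun z ⟨hz, hz0⟩ => z.rep_nonzero ?_
    simp only [Set.mem_ofPred_eq, Matrix.range_cons, Matrix.range_empty, Set.union_empty,
      Set.singleton_union, Submodule.mem_span_pair] at hz
    obtain ⟨α, β, hz⟩ := hz
    obtain ⟨rfl, rfl⟩ := hdef α β (by rw [hz]; exact hz0)
    simpa using hz.symm

theorem not_outsideConic_of_pos (habc : br a b c ≠ 0) (ha : q a = 0) (hb : q b = 0)
    (hc : q c = 0) {p : RP2} (h : 0 < q p.rep * (QuadraticMap.polar q a b *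
      QuadraticMap.polar q b c * QuadraticMap.polar q a c)) : ¬ OutsideConic q p := by
  set k := QuadraticMap.polar q a b * QuadraticMap.polar q b c * QuadraticMap.polar q a c with hkdef
  have hk : k ≠ 0 := fun h0 => by simp [h0] at h
  obtain ⟨u, v, w, hspan, hq⟩ := exists_coord_of_isotropic habc ha hb hc hk
  rintro ⟨_, ⟨W, hW, rfl⟩, hpW, hempty⟩
  replace hpW : p.rep ∈ W := hpW
  obtain ⟨z, hzW, hzp⟩ : ∃ z ∈ W, z ∉ Submodule.span ℝ {p.rep} := by
    by_contra! hle
    have h1 := Submodule.finrank_mono (show W ≤ Submodule.span ℝ {p.rep} from hle)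
    rw [hW, finrank_span_singleton p.rep_nonzero] at h1
    omega
  obtain ⟨X, Y, Z, hp⟩ := hspan p.rep
  obtain ⟨X', Y', Z', hz⟩ := hspan z
  have hpos : 0 < X * Y + Y * Z + X * Z := by
    rw [hp, hq, ← hkdef] at h
    have : 0 < k ^ 2 := by positivity
    nlinarith
  have hsum : X + Y + Z ≠ 0 := fun h0 => by nlinarith [sq_nonneg X, sq_nonneg Y, sq_nonneg Z]
  set r := (X' + Y' + Z') / (X + Y + Z)
  have hr : r * (X + Y + Z) = X' + Y' + Z' := div_mul_cancel₀ _ hsum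
  set A := X' - r * X
  set B := Y' - r * Y
  set C := Z' - r * Z
  have hABC : A + B + C = 0 := by simp only [A, B, C]; linarith
  have hnonpos : A * B + B * C + A * C ≤ 0 := by
    nlinarith [sq_nonneg A, sq_nonneg B, sq_nonneg C]
  set m := A * (Y + Z) + B * (X + Z) + C * (X + Y)
  have hdisc : 0 ≤ discrim (X * Y + Y * Z + X * Z) m (A * B + B * C + A * C) := by
    rw [discrim]
    nlinarith [sq_nonneg m]
  obtain ⟨t, ht⟩ := exists_quadratic_eq_zero hpos.ne'
    ⟨_, (Real.mul_self_sqrt hdisc).symm⟩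
  have hzt : z + (t - r) • p.rep = (A + t * X) • u + (B + t * Y) • v + (C + t * Z) • w := by
    simp only [A, B, C]
    rw [hz, hp]
    module
  have hq0 : q (z + (t - r) • p.rep) = 0 := by
    rw [hzt, hq]
    linear_combination k * ht
  have hne : z + (t - r) • p.rep ≠ 0 := fun h0 => hzp <| by
    rw [eq_neg_of_add_eq_zero_left h0, ← neg_smul]
    exact Submodule.smul_mem _ _ (Submodule.mem_span_singleton_self _)
  obtain ⟨α, hα⟩ := Projectivization.exists_smul_eq_mk_rep ℝ _ hne
  have hmem : Projectivization.mk ℝ _ hne ∈ {z : RP2 | z.rep ∈ W} ∩ ConicSet q := by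
    constructor
    · change _ ∈ W
      rw [← hα]
      exact W.smul_mem _ (W.add_mem hzW (W.smul_mem _ hpW))
    · change q _ = 0
      rw [← hα, Units.smul_def, QuadraticMap.map_smul, hq0, smul_zero]
  rw [hempty] at hmem
  exact hmem

end Conic

/-- For a convexly ordered 5-tuple `x 1, …, x 5`, the sign of `conicDet x` tells whether `x 0`
lies outside the conic through `x 1, …, x 5`. -/
theorem outsideConic_iff_conicDet_pos {x : Fin 6 → Fin 3 → ℝ}
    (hx : ∀ i j k : Fin 6, 0 < i → i < j → j < k → 0 < br (x i) (x j) (x k))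
    (hne : conicDet x ≠ 0) {q : QuadraticForm ℝ (Fin 3 → ℝ)} (hq0 : q ≠ 0)
    (hq : ∀ i, i ≠ 0 → q (x i) = 0) {p : RP2} {r : ℝ} (hr : r ≠ 0) (hp : p.rep = r • x 0) :
    OutsideConic q p ↔ 0 < conicDet x := by
  let Q : QuadraticForm ℝ (Fin 3 → ℝ) :=
    (br (x 1) (x 2) (x 3) * br (x 1) (x 4) (x 5)) •
        QuadraticMap.linMulLin (brForm (x 2) (x 4)) (brForm (x 3) (x 5)) -
      (br (x 1) (x 2) (x 4) * br (x 1) (x 3) (x 5)) •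
        QuadraticMap.linMulLin (brForm (x 2) (x 3)) (brForm (x 4) (x 5))
  have hQ : ∀ z, Q z =
      br (x 1) (x 2) (x 3) * br (x 1) (x 4) (x 5) * (br (x 2) (x 4) z * br (x 3) (x 5) z) -
      br (x 1) (x 2) (x 4) * br (x 1) (x 3) (x 5) * (br (x 2) (x 3) z * br (x 4) (x 5) z) :=
    fun z => rfl
  have hQ0 : Q (x 0) = conicDet x := by rw [hQ, conicDet_eq]; ring
  have hQi : ∀ i, i ≠ 0 → Q (x i) = 0 := fun i hi => by
    rw [hQ]
    fin_cases i
    · exact absurd rfl hi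
    all_goals simp [br_self_left, br_self_right]
    rw [br_cycle (x 1) (x 2) (x 4), br_cycle (x 1) (x 3) (x 5), br_cycle (x 1) (x 2) (x 3),
      br_cycle (x 1) (x 4) (x 5)]
    ring
  set t := q (x 0) / Q (x 0)
  have hqQ : q = t • Q := by
    refine sub_eq_zero.mp (eq_zero_of_conicDet_ne_zero hne fun i => ?_)
    rw [sub_apply, smul_apply, smul_eq_mul]
    by_cases hi : i = 0
    · rw [hi, div_mul_cancel₀ _ (hQ0 ▸ hne), sub_self]
    · rw [hq i hi, hQi i hi, mul_zero, sub_self]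
  have ht : t ≠ 0 := fun h => hq0 (by rw [hqQ, h, zero_smul])
  have b123 := hx 1 2 3 (by decide) (by decide) (by decide)
  have b124 := hx 1 2 4 (by decide) (by decide) (by decide)
  have b125 := hx 1 2 5 (by decide) (by decide) (by decide)
  have b134 := hx 1 3 4 (by decide) (by decide) (by decide)
  have b135 := hx 1 3 5 (by decide) (by decide) (by decide)
  have b145 := hx 1 4 5 (by decide) (by decide) (by decide)
  have b234 := hx 2 3 4 (by decide) (by decide) (by decide)
  have b235 := hx 2 3 5 (by decide) (by decide) (by decide)
  have b245 := hx 2 4 5 (by decide) (by decide) (by decide)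
  have b345 := hx 3 4 5 (by decide) (by decide) (by decide)
  have hpolar : ∀ y z, QuadraticMap.polar Q y z =
      br (x 1) (x 2) (x 3) * br (x 1) (x 4) (x 5) *
        (br (x 2) (x 4) y * br (x 3) (x 5) z + br (x 2) (x 4) z * br (x 3) (x 5) y) -
      br (x 1) (x 2) (x 4) * br (x 1) (x 3) (x 5) *
        (br (x 2) (x 3) y * br (x 4) (x 5) z + br (x 2) (x 3) z * br (x 4) (x 5) y) :=
    fun y z => by
      simp only [QuadraticMap.polar, hQ, ← brForm_apply, map_add]
      ring
  have p23 : QuadraticMap.polar Q (x 2) (x 3) = -(br (x 1) (x 2) (x 3) * br (x 1) (x 4) (x 5) *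
      br (x 2) (x 3) (x 4) * br (x 2) (x 3) (x 5)) := by
    rw [hpolar]
    simp only [br_self_left, br_self_right]
    rw [br_swap (x 2) (x 3) (x 4), br_cycle (x 2) (x 3) (x 5)]
    ring
  have p24 : QuadraticMap.polar Q (x 2) (x 4) = -(br (x 1) (x 2) (x 4) * br (x 1) (x 3) (x 5) *
      br (x 2) (x 3) (x 4) * br (x 2) (x 4) (x 5)) := by
    rw [hpolar]
    simp only [br_self_left, br_self_right]
    rw [br_cycle (x 2) (x 4) (x 5)]
    ring
  have p34 : QuadraticMap.polar Q (x 3) (x 4) = -(br (x 1) (x 2) (x 5) * br (x 1) (x 3) (x 4) *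
      br (x 2) (x 3) (x 4) * br (x 3) (x 4) (x 5)) := by
    rw [hpolar]
    simp only [br_self_left, br_self_right]
    rw [br_swap (x 2) (x 3) (x 4), br_swap (x 3) (x 4) (x 5), br_cycle (x 3) (x 4) (x 5)]
    linear_combination br (x 2) (x 3) (x 4) * br (x 3) (x 4) (x 5) *
      br_pluecker (x 1) (x 2) (x 3) (x 4) (x 5)
  have hk : QuadraticMap.polar Q (x 2) (x 3) * QuadraticMap.polar Q (x 3) (x 4) *
      QuadraticMap.polar Q (x 2) (x 4) < 0 := by
    rw [p23, p24, p34]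
    have : ∀ s t u : ℝ, 0 < s → 0 < t → 0 < u → -s * -t * -u < 0 := fun s t u hs ht hu => by
      have := mul_pos (mul_pos hs ht) hu
      linarith
    exact this _ _ _ (by positivity) (by positivity) (by positivity)
  have hval : q p.rep * (QuadraticMap.polar q (x 2) (x 3) * QuadraticMap.polar q (x 3) (x 4) *
      QuadraticMap.polar q (x 2) (x 4)) = (r ^ 2 * t ^ 4) * (conicDet x *
      (QuadraticMap.polar Q (x 2) (x 3) * QuadraticMap.polar Q (x 3) (x 4) *
      QuadraticMap.polar Q (x 2) (x 4))) := by
    have hpol : ∀ y z, QuadraticMap.polar q y z = t * QuadraticMap.polar Q y z := fun y z => by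
      rw [hqQ, FunLike.coe_smul, QuadraticMap.polar_smul, smul_eq_mul]
    have hqp : q p.rep = r * r * (t * conicDet x) := by
      rw [hp, QuadraticMap.map_smul, ← hQ0, hqQ]
      rfl
    rw [hpol, hpol, hpol, hqp]
    ring
  have hrt : 0 < r ^ 2 * t ^ 4 := by positivity
  have h2 := hq 2 (by decide)
  have h3 := hq 3 (by decide)
  have h4 := hq 4 (by decide)
  constructor
  · intro ho
    by_contra hle
    refine not_outsideConic_of_pos b234.ne' h2 h3 h4 ?_ ho
    rw [hval]
    exact mul_pos hrt (mul_pos_of_neg_of_neg (lt_of_le_of_ne (not_lt.mp hle) hne) hk)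
  · intro hD
    refine outsideConic_of_neg b234.ne' h2 h3 h4 ?_
    rw [hval]
    exact mul_neg_of_pos_of_neg hrt (mul_neg_of_pos_of_neg hD hk)

theorem outAll_iff_conicDet_pos {f : Fin 7 → RP2} {y : Fin 7 → Fin 3 → ℝ} {r : Fin 7 → ℝ}
    (hr : ∀ k, r k ≠ 0) (hf : ∀ k, (f k).rep = r k • y k) {j : Fin 7} {e : Fin 6 → Fin 7}
    (hj : ∀ m, e m ≠ j) (he0 : ∀ m, m ≠ 0 → e m ≠ e 0)
    (he : ∀ k, k ≠ e 0 → k ≠ j → ∃ m, m ≠ 0 ∧ e m = k)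
    (hx : ∀ a b c : Fin 6, 0 < a → a < b → b < c → 0 < br (y (e a)) (y (e b)) (y (e c)))
    (hne : conicDet (y ∘ e) ≠ 0) : OutAll f (e 0) j ↔ 0 < conicDet (y ∘ e) := by
  have key : ∀ q : QuadraticForm ℝ (Fin 3 → ℝ), q ≠ 0 → (∀ m, m ≠ 0 → q (y (e m)) = 0) →
      (OutsideConic q (f (e 0)) ↔ 0 < conicDet (y ∘ e)) := fun q hq0 hq =>
    outsideConic_iff_conicDet_pos hx hne hq0 hq (hr _) (hf _)
  constructor
  · intro h
    obtain ⟨q, hq0, hq⟩ := exists_quadraticForm_of_conicDet_eq_zero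
      (x := fun m => if m = 0 then y (e 1) else y (e m)) (Matrix.det_zero_of_row_eq
        (i := 0) (j := 1) (by decide) rfl)
    have hq' : ∀ m, m ≠ 0 → q (y (e m)) = 0 := fun m hm => by simpa [hm] using hq m
    refine (key q hq0 hq').mp (h q hq0 fun k hk hkj => ?_)
    obtain ⟨m, hm, rfl⟩ := he k hk hkj
    rw [hf, QuadraticMap.map_smul, hq' m hm, smul_zero]
  · intro h q hq0 hq
    refine (key q hq0 fun m hm => ?_).mpr h
    have := hq (e m) (he0 m hm) (hj m)
    rw [hf, QuadraticMap.map_smul, smul_eq_mul] at this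
    exact (mul_eq_zero.mp this).resolve_left (mul_ne_zero (hr _) (hr _))

theorem conicDet_ne_zero_of_typicalCfg {n : ℕ} {f : Fin n → RP2} (h : TypicalCfg f)
    {y : Fin n → Fin 3 → ℝ} {r : Fin n → ℝ} (hf : ∀ k, (f k).rep = r k • y k)
    {e : Fin 6 → Fin n} (he : Function.Injective e) : conicDet (y ∘ e) ≠ 0 := fun h0 => by
  obtain ⟨q, hq0, hq⟩ := exists_quadraticForm_of_conicDet_eq_zero h0
  refine h.2 e he ⟨q, hq0, ?_⟩
  rintro _ ⟨m, rfl⟩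
  change q (f (e m)).rep = 0
  rw [hf, QuadraticMap.map_smul, show q (y (e m)) = 0 from hq m, smul_zero]

theorem br_rep_ne_zero {a b c : RP2} (h : ¬ Collin a b c) : br a.rep b.rep c.rep ≠ 0 := by
  rw [Collin, not_not] at h
  exact ((Matrix.isUnit_iff_isUnit_det _).mp
    (Matrix.linearIndependent_rows_iff_isUnit.mp h)).ne_zero

/-- Points in convex position with consecutive labels have representatives for which all
determinants `br (y k) (y (k + 1)) (y j)` are positive. -/
theorem exists_positive_representatives {f : Fin 7 → RP2} (hf : SimpleCfg f)
    (hconv : ConsecConvexPos f) : ∃ (y : Fin 7 → Fin 3 → ℝ) (r : Fin 7 → ℝ), (∀ k, r k ≠ 0) ∧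
      (∀ k, (f k).rep = r k • y k) ∧
      ∀ k j, j ≠ k → j ≠ k + 1 → 0 < br (y k) (y (k + 1)) (y j) := by
  obtain ⟨φ, ⟨-, hφ, -⟩, hψ⟩ := hconv
  set v : Fin 7 → Fin 3 → ℝ := fun k => chart φ (f k) with hv
  have hφv : ∀ k, φ (v k) = 1 := fun k => by simp [hv, chart, hφ k]
  have hne : ∀ i j k, i ≠ j → i ≠ k → j ≠ k → br (v i) (v j) (v k) ≠ 0 :=
    fun i j k hij hik hjk => by
      simp only [hv, chart, br_smul]
      have := br_rep_ne_zero (hf.2 i j k hij hik hjk)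
      have := hφ i
      have := hφ j
      have := hφ k
      positivity
  have hside : ∀ k i j, i ≠ k → i ≠ k + 1 → j ≠ k → j ≠ k + 1 →
      0 < br (v k) (v (k + 1)) (v i) * br (v k) (v (k + 1)) (v j) :=
    fun k i j hik hik' hjk hjk' => by
      obtain ⟨ψ, hψ0, hψ1⟩ := hψ k
      let χ := ψ - ψ (v k) • φ
      have hχ : ∀ l, χ (v l) = ψ (v l) - ψ (v k) := fun l => by simp [χ, hφv]
      have hχk : χ (v k) = 0 := by rw [hχ, sub_self]
      have hχk' : χ (v (k + 1)) = 0 := by rw [hχ, sub_eq_zero]; exact hψ0.symm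
      have hi : χ (v i) < 0 := by rw [hχ]; exact sub_neg.mpr (hψ1 i hik hik')
      have hj : χ (v j) < 0 := by rw [hχ]; exact sub_neg.mpr (hψ1 j hjk hjk')
      have h := congrArg χ (br_smul_eq (v k) (v (k + 1)) (v i) (v j))
      simp only [map_add, map_smul, hχk, hχk', smul_eq_mul, mul_zero, zero_add] at h
      have hb := hne k (k + 1) i (by fin_cases k <;> decide) hik.symm hik'.symm
      have h1 : 0 < br (v k) (v (k + 1)) (v i) ^ 2 := by positivity
      have h2 : 0 < χ (v i) * χ (v j) := mul_pos_of_neg_of_neg hi hj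
      have h3 := mul_pos h1 h2
      have h4 : br (v k) (v (k + 1)) (v i) ^ 2 * (χ (v i) * χ (v j)) =
          χ (v i) ^ 2 * (br (v k) (v (k + 1)) (v i) * br (v k) (v (k + 1)) (v j)) := by
        linear_combination br (v k) (v (k + 1)) (v i) * χ (v i) * h
      rw [h4] at h3
      exact pos_of_mul_pos_right h3 (sq_nonneg _)
  set s : Fin 7 → ℝ := fun k => br (v k) (v (k + 1)) (v (k + 1 + 1)) with hs
  have hstep : ∀ k, 0 < s k * s (k + 1) := fun k => by
    have := hside (k + 1) k (k + 1 + 1 + 1) (by clear * -; decide +revert)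
      (by clear * -; decide +revert)
      (by clear * -; decide +revert) (by clear * -; decide +revert)
    rwa [br_cycle (v k)] at this
  have hs0 : s 0 ≠ 0 := left_ne_zero_of_mul (hstep 0).ne'
  have hsign : ∀ k, 0 < s 0 * s k := fun k => by
    induction k using Fin.induction with
    | zero => exact mul_self_pos.mpr hs0
    | succ k ih =>
      have h1 := mul_pos ih (hstep k.castSucc)
      rw [Fin.coeSucc_eq_succ] at h1
      have h2 : s 0 * s k.castSucc * (s k.castSucc * s k.succ) =
          s k.castSucc ^ 2 * (s 0 * s k.succ) := by ring
      rw [h2] at h1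
      exact pos_of_mul_pos_right h1 (sq_nonneg _)
  refine ⟨fun k => s 0 • v k, fun k => φ (f k).rep / s 0, fun k => div_ne_zero (hφ k) hs0,
    fun k => ?_, fun k j hk hk' => ?_⟩
  · simp only [hv, chart, smul_smul]
    rw [← mul_assoc, div_mul_cancel₀ _ hs0, mul_inv_cancel₀ (hφ k), one_smul]
  · rw [br_smul]
    have h1 := hsign k
    have h2 := hside k (k + 1 + 1) j (by clear * -; decide +revert)
      (by clear * -; decide +revert) hk hk'
    have h3 := mul_pos h1 h2
    have h4 : s 0 * s k * (br (v k) (v (k + 1)) (v (k + 1 + 1)) * br (v k) (v (k + 1)) (v j)) =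
        s k ^ 2 * (s 0 * br (v k) (v (k + 1)) (v j)) := by
      simp only [hs]; ring
    rw [h4] at h3
    have h5 := pos_of_mul_pos_right h3 (sq_nonneg _)
    have h6 : 0 < s 0 ^ 2 := by positivity
    have h7 := mul_pos h6 h5
    linarith

theorem br_pos_of_adjacent_pos {y : Fin 7 → Fin 3 → ℝ}
    (h : ∀ k j, j ≠ k → j ≠ k + 1 → 0 < br (y k) (y (k + 1)) (y j)) {a b c : Fin 7}
    (hab : a < b) (hbc : b < c) : 0 < br (y a) (y b) (y c) := by
  have hskip : ∀ k : Fin 7, 0 < br (y k) (y (k + 2)) (y (k + 4)) := fun k => by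
    have h1 := h k (k + 2) (by clear * -; decide +revert) (by clear * -; decide +revert)
    have h2 := h k (k + 3) (by clear * -; decide +revert) (by clear * -; decide +revert)
    have h3 := h k (k + 4) (by clear * -; decide +revert) (by clear * -; decide +revert)
    have h4 := h (k + 3) k (by clear * -; decide +revert) (by clear * -; decide +revert)
    have h5 := h (k + 2) k (by clear * -; decide +revert) (by clear * -; decide +revert)
    rw [br_cycle (y k), show k + 3 + 1 = k + 4 by clear * -; decide +revert] at h4
    rw [br_cycle (y k), show k + 2 + 1 = k + 3 by clear * -; decide +revert] at h5
    have := br_pluecker (y k) (y (k + 1)) (y (k + 2)) (y (k + 3)) (y (k + 4))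
    refine pos_of_mul_pos_right (a := br (y k) (y (k + 1)) (y (k + 3))) ?_ h2.le
    linarith [mul_pos h1 h4, mul_pos h3 h5]
  have hcases : ∀ a b c : Fin 7, a < b → b < c → b = a + 1 ∨ c = b + 1 ∨ a = c + 1 ∨
      (b = a + 2 ∧ c = a + 4) ∨ (c = b + 2 ∧ a = b + 4) ∨ (a = c + 2 ∧ b = c + 4) := by
    decide
  rcases hcases a b c hab hbc with rfl | rfl | rfl | ⟨rfl, rfl⟩ | ⟨rfl, rfl⟩ | ⟨rfl, rfl⟩
  · exact h _ _ (hab.trans hbc).ne' hbc.ne'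
  · rw [← br_cycle]
    exact h _ _ hab.ne (hab.trans hbc).ne
  · rw [br_cycle]
    exact h _ _ hbc.ne hab.ne'
  · exact hskip _
  · rw [← br_cycle]
    exact hskip _
  · rw [← br_cycle, ← br_cycle]
    exact hskip _

/-- The alternation statement at the vertex `0`, from which the general one follows by rotating
the labels. -/
theorem didx_alternation_at_zero {f : Fin 7 → RP2} (hf : TypicalCfg f)
    (hconv : ConsecConvexPos f) (h0 : domIdx f 0 ≠ 0) (h6 : domIdx f 0 ≠ 6) :
    dIdx f 6 0 ≠ dIdx f 0 1 := by
  obtain ⟨y, r, hr, hfy, hadj⟩ := exists_positive_representatives hf.1 hconv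
  have hpos : ∀ a b c : Fin 7, a < b → b < c → 0 < br (y a) (y b) (y c) :=
    fun _ _ _ => br_pos_of_adjacent_pos hadj
  set V : Fin 7 → ℝ := fun j => conicDet (y ∘ j.succAbove) with hV
  have hVne : ∀ j, V j ≠ 0 := fun j =>
    conicDet_ne_zero_of_typicalCfg hf hfy (Fin.succAbove_right_injective)
  have hd0 : ∀ j, j ≠ 0 → (OutAll f 0 j ↔ 0 < V j) := fun j hj => by
    have := outAll_iff_conicDet_pos (j := j) (e := j.succAbove) hr hfy
      (fun m => Fin.succAbove_ne j m)
      (fun m hm h => hm (Fin.succAbove_right_injective h))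
      (fun k hk hkj => by
        obtain ⟨m, rfl⟩ := Fin.exists_succAbove_eq hkj
        exact ⟨m, fun h => hk (by rw [h]), rfl⟩)
      (fun a b c _ hab hbc => hpos _ _ _ (Fin.strictMono_succAbove j hab)
        (Fin.strictMono_succAbove j hbc)) (hVne j)
    rwa [Fin.succAbove_ne_zero_zero hj] at this
  have hd6 : OutAll f 6 0 ↔ V 0 < 0 := by
    let σ : Equiv.Perm (Fin 6) := (finRotate 6)⁻¹
    have hmono : ∀ a b : Fin 6, 0 < a → a < b → (Fin.succ ∘ σ) a < (Fin.succ ∘ σ) b := by decide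
    have hσ : conicDet (y ∘ (Fin.succ ∘ σ)) = -V 0 := by
      have := Matrix.det_permute σ (Matrix.of fun m => veronese (y (Fin.succ m)))
      rw [Equiv.Perm.sign_inv, sign_finRotate] at this
      refine Eq.trans this ?_
      simp [V, conicDet]
    have := outAll_iff_conicDet_pos (j := 0) (e := Fin.succ ∘ σ) hr hfy
      (fun m => Fin.succ_ne_zero _)
      (fun m hm h => hm (σ.injective (Fin.succ_injective _ h)))
      (fun k hk hk0 => by
        obtain ⟨m, rfl⟩ := Fin.exists_succ_eq.mpr hk0
        refine ⟨σ.symm m, fun h => hk ?_, by simp⟩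
        rw [← h]; simp)
      (fun a b c ha hab hbc => hpos _ _ _ (hmono a b ha hab) (hmono b c (ha.trans hab) hbc))
      (by rw [hσ]; exact neg_ne_zero.mpr (hVne 0))
    rwa [hσ, neg_pos, show (Fin.succ ∘ σ) 0 = 6 by decide] at this
  intro heq
  have hiff : V 0 < 0 ↔ 0 < V 1 := by
    rw [← hd6, ← hd0 1 (by decide)]
    unfold dIdx at heq
    split_ifs at heq <;> tauto
  have h01 : V 0 * V 1 < 0 := by
    rcases lt_or_gt_of_ne (hVne 0) with h | h
    · exact mul_neg_of_neg_of_pos h (hiff.mp h)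
    · exact mul_neg_of_pos_of_neg h
        (lt_of_le_of_ne (not_lt.mp fun h1 => h.not_gt (hiff.mpr h1)) (hVne 1))
  have hstep : ∀ {α β γ : ℝ} {j : Fin 7}, 0 < α → 0 < β → 0 < γ →
      α * V 0 - β * V 1 + γ * V j = 0 → 0 < V 1 * V j := fun {α β γ j} hα hβ hγ h => by
    refine pos_of_mul_pos_right (a := γ) ?_ hγ.le
    have h1 : γ * (V 1 * V j) = β * V 1 ^ 2 + α * -(V 0 * V 1) := by
      linear_combination V 1 * h
    have h2 : 0 < V 1 ^ 2 := sq_pos_of_ne_zero (hVne 1)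
    rw [h1]
    exact add_pos (mul_pos hβ h2) (mul_pos hα (neg_pos.mpr h01))
  have hrel : ∀ a b c d : Fin 7, V 0 * (br (y a) (y b) (y 0) * br (y c) (y d) (y 0)) -
      V 1 * (br (y a) (y b) (y 1) * br (y c) (y d) (y 1)) +
      V 2 * (br (y a) (y b) (y 2) * br (y c) (y d) (y 2)) -
      V 3 * (br (y a) (y b) (y 3) * br (y c) (y d) (y 3)) +
      V 4 * (br (y a) (y b) (y 4) * br (y c) (y d) (y 4)) -
      V 5 * (br (y a) (y b) (y 5) * br (y c) (y d) (y 5)) +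
      V 6 * (br (y a) (y b) (y 6) * br (y c) (y d) (y 6)) = 0 := fun a b c d => by
    have := sum_conicDet_mul y
      (QuadraticMap.linMulLin (brForm (y a) (y b)) (brForm (y c) (y d)))
    rw [Fin.sum_univ_seven] at this
    simp only [QuadraticMap.linMulLin_apply, brForm_apply] at this
    change (-1) ^ 0 * _ * V 0 + (-1) ^ 1 * _ * V 1 + (-1) ^ 2 * _ * V 2 + (-1) ^ 3 * _ * V 3 +
      (-1) ^ 4 * _ * V 4 + (-1) ^ 5 * _ * V 5 + (-1) ^ 6 * _ * V 6 = 0 at this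
    linear_combination this
  have hpos2 : ∀ a b c d e g : Fin 7, a < b → b < c → d < e → e < g →
      0 < br (y a) (y b) (y c) * br (y d) (y e) (y g) :=
    fun _ _ _ _ _ _ hab hbc hde heg => mul_pos (hpos _ _ _ hab hbc) (hpos _ _ _ hde heg)
  have h2 : 0 < V 1 * V 2 := by
    refine hstep (hpos2 0 3 4 0 5 6 ?_ ?_ ?_ ?_) (hpos2 1 3 4 1 5 6 ?_ ?_ ?_ ?_)
      (hpos2 2 3 4 2 5 6 ?_ ?_ ?_ ?_) ?_
    on_goal 13 =>
      have := hrel 3 4 5 6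
      simp only [br_self_left, br_self_right] at this
      simp only [← br_cycle (y 0), ← br_cycle (y 1), ← br_cycle (y 2)]
      linarith
    all_goals decide
  have h3 : 0 < V 1 * V 3 := by
    refine hstep (hpos2 0 2 4 0 5 6 ?_ ?_ ?_ ?_) (hpos2 1 2 4 1 5 6 ?_ ?_ ?_ ?_)
      (hpos2 2 3 4 3 5 6 ?_ ?_ ?_ ?_) ?_
    on_goal 13 =>
      have := hrel 2 4 5 6
      simp only [br_self_left, br_self_right, br_swap (y 2) (y 3) (y 4)] at this
      simp only [← br_cycle (y 0), ← br_cycle (y 1), ← br_cycle (y 3) (y 5)]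
      linarith
    all_goals decide
  have h4 : 0 < V 1 * V 4 := by
    refine hstep (hpos2 0 2 3 0 5 6 ?_ ?_ ?_ ?_) (hpos2 1 2 3 1 5 6 ?_ ?_ ?_ ?_)
      (hpos2 2 3 4 4 5 6 ?_ ?_ ?_ ?_) ?_
    on_goal 13 =>
      have := hrel 2 3 5 6
      simp only [br_self_left, br_self_right] at this
      simp only [← br_cycle (y 0), ← br_cycle (y 1), ← br_cycle (y 4)]
      linarith
    all_goals decide
  have h5 : 0 < V 1 * V 5 := by
    refine hstep (hpos2 0 2 3 0 4 6 ?_ ?_ ?_ ?_) (hpos2 1 2 3 1 4 6 ?_ ?_ ?_ ?_)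
      (hpos2 2 3 5 4 5 6 ?_ ?_ ?_ ?_) ?_
    on_goal 13 =>
      have := hrel 2 3 4 6
      simp only [br_self_left, br_self_right, br_swap (y 4) (y 5) (y 6)] at this
      simp only [← br_cycle (y 0), ← br_cycle (y 1)]
      linarith
    all_goals decide
  have h6' : 0 < V 1 * V 6 := by
    refine hstep (hpos2 0 2 3 0 4 5 ?_ ?_ ?_ ?_) (hpos2 1 2 3 1 4 5 ?_ ?_ ?_ ?_)
      (hpos2 2 3 6 4 5 6 ?_ ?_ ?_ ?_) ?_
    on_goal 13 =>
      have := hrel 2 3 4 5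
      simp only [br_self_left, br_self_right] at this
      simp only [← br_cycle (y 0), ← br_cycle (y 1)]
      linarith
    all_goals decide
  have hall : ∀ j, j ≠ 0 → 0 < V 1 * V j := fun j hj => by
    fin_cases j
    · exact absurd rfl hj
    · exact mul_self_pos.mpr (hVne 1)
    · exact h2
    · exact h3
    · exact h4
    · exact h5
    · exact h6'
  rcases lt_or_gt_of_ne (hVne 1) with h | h
  · refine h0 (Finset.sum_eq_zero fun j hj => if_neg ?_)
    rw [hd0 j (Finset.ne_of_mem_erase hj), not_lt]
    exact (neg_of_mul_pos_right (hall j (Finset.ne_of_mem_erase hj)) h.le).le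
  · refine h6 ((Finset.sum_congr rfl fun j hj => if_pos ?_).trans (by simp))
    rw [hd0 j (Finset.ne_of_mem_erase hj)]
    exact pos_of_mul_pos_right (hall j (Finset.ne_of_mem_erase hj)) h.le

section Rotate

variable (f : Fin 7 → RP2) (i : Fin 7)

theorem outAll_rotate (a b : Fin 7) :
    OutAll (fun k => f (k + i)) a b ↔ OutAll f (a + i) (b + i) := by
  unfold OutAll
  refine forall₂_congr fun q _ => imp_congr_left ?_
  conv_rhs => rw [← (Equiv.addRight i).forall_congr_right]
  simp

theorem dIdx_rotate (a b : Fin 7) :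
    dIdx (fun k => f (k + i)) a b = dIdx f (a + i) (b + i) := by
  classical
  unfold dIdx
  exact if_congr (outAll_rotate f i a b) rfl rfl

theorem domIdx_rotate : domIdx (fun k => f (k + i)) 0 = domIdx f i := by
  unfold domIdx
  refine Finset.sum_equiv (Equiv.addRight i) (fun j => by simp) fun j _ => ?_
  rw [dIdx_rotate, zero_add]
  rfl

variable {f}

theorem TypicalCfg.rotate (h : TypicalCfg f) : TypicalCfg fun k => f (k + i) := by
  have hinj : Function.Injective fun k : Fin 7 => k + i := add_left_injective i
  refine ⟨⟨h.1.1.comp hinj, fun a b c hab hac hbc => ?_⟩, fun g hg => h.2 _ (hinj.comp hg)⟩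
  exact h.1.2 _ _ _ (hinj.ne hab) (hinj.ne hac) (hinj.ne hbc)

theorem ConsecConvexPos.rotate (h : ConsecConvexPos f) :
    ConsecConvexPos fun k => f (k + i) := by
  have hinj : Function.Injective fun k : Fin 7 => k + i := add_left_injective i
  obtain ⟨φ, ⟨hφ, hφf, hconv⟩, hψ⟩ := h
  refine ⟨φ, ⟨hφ, fun k => hφf _, fun k hk => hconv (k + i) (convexHull_mono ?_ hk)⟩, fun k => ?_⟩
  · refine Set.image_mono ?_
    rintro _ ⟨j, hj, rfl⟩
    exact ⟨j + i, hinj.ne hj, rfl⟩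
  · obtain ⟨ψ, h1, h2⟩ := hψ (k + i)
    rw [add_right_comm] at h1 h2
    exact ⟨ψ, h1, fun j hj hj' => h2 _ (hinj.ne hj) (hinj.ne hj')⟩

end Rotate

/-- For a heptagonal typical 7-configuration numbered consecutively along the convex
position, if `d(p_i) ∉ {0, 6}` then `d_{i-1,i} ≠ d_{i,i+1}`. -/
theorem didx_alternation_at_vertex (f : Fin 7 → RP2)
    (hf : TypicalCfg f) (hconv : ConsecConvexPos f)
    (i : Fin 7) (h0 : domIdx f i ≠ 0) (h6 : domIdx f i ≠ 6) :
    dIdx f (i - 1) i ≠ dIdx f i (i + 1) := by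
  rw [← domIdx_rotate] at h0 h6
  have h := didx_alternation_at_zero (hf.rotate i) (hconv.rotate i) h0 h6
  rwa [dIdx_rotate, dIdx_rotate, zero_add, add_comm 1 i,
    show 6 + i = i - 1 by clear * -; decide +revert] at h

end
end

section
/- Let P be a heptagonal typical 7-configuration with points p₀,…,p₆ numbered consecutively along the cyclic order coming from convex position (indices modulo 7). Then: (i) every special edge [p_i, p_{i+1}] joins a point of dominance index 0 to a point of dominance index 6, i.e., {d(p_i), d(p_{i+1})} = {0, 6}; (ii) there is exactly one index i for which the edge [p_i, p_{i+1}] is special; (iii) internal and external edges alternate around the heptagon: if both [p_i, p_{i+1}] and [p_{i+1}, p_{i+2}] are non-special, then one of them is internal and the other is external. -/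
open scoped LinearAlgebra.Projectivization
open Projectivization

noncomputable section

/-- The edge `[p_i, p_{i+1}]` of the heptagon is internal: `d_{i,i+1} = d_{i+1,i} = 0`. -/
def InternalEdge (f : Fin 7 → RP2) (i : Fin 7) : Prop :=
  dIdx f i (i + 1) = 0 ∧ dIdx f (i + 1) i = 0

/-- The edge `[p_i, p_{i+1}]` of the heptagon is external: `d_{i,i+1} = d_{i+1,i} = 1`. -/
def ExternalEdge (f : Fin 7 → RP2) (i : Fin 7) : Prop :=
  dIdx f i (i + 1) = 1 ∧ dIdx f (i + 1) i = 1

/-- The edge `[p_i, p_{i+1}]` of the heptagon is special: neither internal nor external. -/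
def SpecialEdge (f : Fin 7 → RP2) (i : Fin 7) : Prop :=
  ¬ InternalEdge f i ∧ ¬ ExternalEdge f i

/-- The determinant of three vectors of `ℝ³`. -/
def bracket (a b c : Fin 3 → ℝ) : ℝ :=
  a 0 * (b 1 * c 2 - b 2 * c 1) - a 1 * (b 0 * c 2 - b 2 * c 0) + a 2 * (b 0 * c 1 - b 1 * c 0)

theorem bracket_swap_left (a b c : Fin 3 → ℝ) : bracket a b c = -bracket b a c := by
  simp only [bracket]; ring

theorem bracket_swap_right (a b c : Fin 3 → ℝ) : bracket a b c = -bracket a c b := by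
  simp only [bracket]; ring

theorem bracket_self_left (a b : Fin 3 → ℝ) : bracket a b a = 0 := by
  simp only [bracket]; ring

theorem bracket_self_right (a b : Fin 3 → ℝ) : bracket a b b = 0 := by
  simp only [bracket]; ring

theorem bracket_neg (a b c : Fin 3 → ℝ) : bracket (-a) (-b) (-c) = -bracket a b c := by
  simp only [bracket, Pi.neg_apply]; ring

theorem bracket_smul (r s t : ℝ) (a b c : Fin 3 → ℝ) :
    bracket (r • a) (s • b) (t • c) = r * s * t * bracket a b c := by
  simp only [bracket, Pi.smul_apply, smul_eq_mul]; ring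

/-- The three-term Grassmann–Plücker relation. -/
theorem bracket_plucker (a b c d e : Fin 3 → ℝ) :
    bracket a b c * bracket a d e - bracket a b d * bracket a c e
      + bracket a b e * bracket a c d = 0 := by
  simp only [bracket]; ring

/-- Cramer's rule. -/
theorem bracket_smul_eq (a b c x : Fin 3 → ℝ) :
    bracket a b c • x = bracket x b c • a + bracket a x c • b + bracket a b x • c := by
  ext i
  simp only [bracket, Pi.smul_apply, Pi.add_apply, smul_eq_mul]
  fin_cases i <;> simp <;> ring

theorem linearIndependent_iff_bracket_ne_zero (a b c : Fin 3 → ℝ) :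
    LinearIndependent ℝ ![a, b, c] ↔ bracket a b c ≠ 0 := by
  have h := Matrix.linearIndependent_rows_iff_isUnit (K := ℝ) (A := Matrix.of ![a, b, c])
  rw [Matrix.isUnit_iff_isUnit_det, isUnit_iff_ne_zero, Matrix.det_fin_three] at h
  have e : bracket a b c = a 0 * b 1 * c 2 - a 0 * b 2 * c 1 - a 1 * b 0 * c 2 + a 1 * b 2 * c 0
      + a 2 * b 0 * c 1 - a 2 * b 1 * c 0 := by
    simp only [bracket]; ring
  rw [e]
  simpa using h

/-- The linear form `x ↦ bracket a b x`. -/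
def bracketForm (a b : Fin 3 → ℝ) : (Fin 3 → ℝ) →ₗ[ℝ] ℝ where
  toFun x := bracket a b x
  map_add' x y := by simp only [bracket, Pi.add_apply]; ring
  map_smul' r x := by simp only [bracket, Pi.smul_apply, smul_eq_mul, RingHom.id_apply]; ring

theorem bracketForm_apply (a b x : Fin 3 → ℝ) : bracketForm a b x = bracket a b x := rfl

/-- The bracket expression of six vectors which vanishes when they lie on a common conic. -/
def hexBracket (a b c d e x : Fin 3 → ℝ) : ℝ :=
  bracket a d e * bracket b c e * (bracket a b x * bracket c d x)
    - bracket a b e * bracket c d e * (bracket a d x * bracket b c x)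

theorem hexBracket_swap₁ (a b c d e x : Fin 3 → ℝ) :
    hexBracket a b c d e x = -hexBracket b a c d e x := by
  simp only [hexBracket, bracket]; ring

theorem hexBracket_swap₂ (a b c d e x : Fin 3 → ℝ) :
    hexBracket a b c d e x = -hexBracket a c b d e x := by
  simp only [hexBracket, bracket]; ring

theorem hexBracket_swap₃ (a b c d e x : Fin 3 → ℝ) :
    hexBracket a b c d e x = -hexBracket a b d c e x := by
  simp only [hexBracket, bracket]; ring

theorem hexBracket_swap₄ (a b c d e x : Fin 3 → ℝ) :
    hexBracket a b c d e x = -hexBracket a b c e d x := by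
  simp only [hexBracket, bracket]; ring

theorem hexBracket_swap₅ (a b c d e x : Fin 3 → ℝ) :
    hexBracket a b c d e x = -hexBracket a b c d x e := by
  simp only [hexBracket]; ring

theorem hexBracket_relation (w x y z a b c : Fin 3 → ℝ) :
    hexBracket w x y z b c * (bracket w x a * bracket y z a)
      - hexBracket w x y z a c * (bracket w x b * bracket y z b)
      + hexBracket w x y z a b * (bracket w x c * bracket y z c) = 0 := by
  simp only [hexBracket]; ring

theorem nonempty_inter_conicSet {q : QuadraticForm ℝ (Fin 3 → ℝ)} {W : Submodule ℝ (Fin 3 → ℝ)}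
    {x : Fin 3 → ℝ} (hx : x ≠ 0) (hW : x ∈ W) (hq : q x = 0) :
    ({p : RP2 | p.rep ∈ W} ∩ ConicSet q).Nonempty := by
  obtain ⟨a, ha⟩ := Projectivization.exists_smul_eq_mk_rep ℝ x hx
  have ha' : (Projectivization.mk ℝ x hx).rep = (a : ℝ) • x := ha.symm
  refine ⟨Projectivization.mk ℝ x hx, ?_, ?_⟩
  · simpa only [Set.mem_ofPred_eq, ha'] using W.smul_mem _ hW
  · simp only [ConicSet, Set.mem_ofPred_eq, ha', QuadraticMap.map_smul, hq, smul_zero]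

/-- The second elementary symmetric polynomial in three variables. -/
def esymm (y : Fin 3 → ℝ) : ℝ := y 0 * y 1 + y 1 * y 2 + y 2 * y 0

theorem exists_esymm_add_smul_eq_zero {y : Fin 3 → ℝ} (hy : 0 < esymm y) (z : Fin 3 → ℝ) :
    ∃ t : ℝ, esymm (z + t • y) = 0 := by
  set s := y 0 + y 1 + y 2 with hs
  set B := y 0 * z 1 + y 1 * z 0 + y 1 * z 2 + y 2 * z 1 + y 2 * z 0 + y 0 * z 2 with hB
  have hs0 : 0 < s ^ 2 := by
    simp only [esymm] at hy
    nlinarith [sq_nonneg (y 0), sq_nonneg (y 1), sq_nonneg (y 2)]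
  have hdisc : 0 ≤ discrim (esymm y) B (esymm z) := by
    refine nonneg_of_mul_nonneg_right (a := s ^ 2) ?_ hs0
    set w : Fin 3 → ℝ := s • z - (z 0 + z 1 + z 2) • y with hw
    have hE : 2 * esymm w = -(w 0 ^ 2 + w 1 ^ 2 + w 2 ^ 2) := by
      simp only [esymm, hw, hs, Pi.sub_apply, Pi.smul_apply, smul_eq_mul]; ring
    have key : s ^ 2 * discrim (esymm y) B (esymm z) =
        (y 0 * w 1 + y 1 * w 0 + y 1 * w 2 + y 2 * w 1 + y 2 * w 0 + y 0 * w 2) ^ 2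
          - 4 * esymm y * esymm w := by
      simp only [discrim, hB, esymm, hw, hs, Pi.sub_apply, Pi.smul_apply, smul_eq_mul]; ring
    rw [key]
    nlinarith [mul_nonneg hy.le (sq_nonneg (w 0)), mul_nonneg hy.le (sq_nonneg (w 1)),
      mul_nonneg hy.le (sq_nonneg (w 2)),
      sq_nonneg (y 0 * w 1 + y 1 * w 0 + y 1 * w 2 + y 2 * w 1 + y 2 * w 0 + y 0 * w 2)]
  obtain ⟨t, ht⟩ := exists_quadratic_eq_zero hy.ne' ⟨_, (Real.mul_self_sqrt hdisc).symm⟩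
  refine ⟨t, Eq.trans ?_ ht⟩
  simp only [esymm, hB, Pi.add_apply, Pi.smul_apply, smul_eq_mul]
  ring

theorem not_outsideConic_of_esymm_pos {q : QuadraticForm ℝ (Fin 3 → ℝ)}
    (L : (Fin 3 → ℝ) ≃ₗ[ℝ] (Fin 3 → ℝ)) {K : ℝ} (hq : ∀ y, q (L y) = K * esymm y)
    {p : RP2} (hp : 0 < esymm (L.symm p.rep)) : ¬ OutsideConic q p := by
  rintro ⟨_, ⟨W, hW, rfl⟩, hpW, hdisj⟩
  have hpW' : p.rep ∈ W := hpW
  obtain ⟨u, huW, hu⟩ : ∃ u ∈ W, u ∉ Submodule.span ℝ {p.rep} := by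
    by_contra! h
    have h1 := Submodule.finrank_mono (show W ≤ Submodule.span ℝ {p.rep} from h)
    rw [hW, finrank_span_singleton p.rep_nonzero] at h1
    omega
  obtain ⟨t, ht⟩ := exists_esymm_add_smul_eq_zero hp (L.symm u)
  have hx : u + t • p.rep ≠ 0 := by
    intro h
    refine hu (Submodule.mem_span_singleton.2 ⟨-t, ?_⟩)
    rw [neg_smul]
    exact (eq_neg_of_add_eq_zero_left h).symm
  have hqx : q (u + t • p.rep) = 0 := by
    have := hq (L.symm u + t • L.symm p.rep)
    simpa [ht] using this
  exact (nonempty_inter_conicSet hx (W.add_mem huW (W.smul_mem t hpW')) hqx).ne_empty hdisj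

theorem outsideConic_of_esymm_neg {q : QuadraticForm ℝ (Fin 3 → ℝ)}
    (L : (Fin 3 → ℝ) ≃ₗ[ℝ] (Fin 3 → ℝ)) {K : ℝ} (hK : K ≠ 0) (hq : ∀ y, q (L y) = K * esymm y)
    {p : RP2} (hp : esymm (L.symm p.rep) < 0) : OutsideConic q p := by
  set y := L.symm p.rep with hy
  set u : Fin 3 → ℝ := ![y 2 - y 1, y 0 - y 2, y 1 - y 0] with hu
  have hE : ∀ α β : ℝ, 2 * esymm (α • y + β • u) = α ^ 2 * (2 * esymm y)
      - β ^ 2 * ((y 2 - y 1) ^ 2 + (y 0 - y 2) ^ 2 + (y 1 - y 0) ^ 2) := by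
    intro α β
    simp [esymm, hu]
    ring
  have hu0 : 0 < (y 2 - y 1) ^ 2 + (y 0 - y 2) ^ 2 + (y 1 - y 0) ^ 2 := by
    simp only [esymm] at hp
    nlinarith [sq_nonneg (y 0), sq_nonneg (y 1), sq_nonneg (y 2)]
  have hzero : ∀ α β : ℝ, esymm (α • y + β • u) = 0 → α = 0 ∧ β = 0 := by
    intro α β h
    have h1 := hE α β
    rw [h] at h1
    have h2 : 0 ≤ α ^ 2 * (-(2 * esymm y)) := mul_nonneg (sq_nonneg α) (by linarith)
    have h3 : 0 ≤ β ^ 2 * ((y 2 - y 1) ^ 2 + (y 0 - y 2) ^ 2 + (y 1 - y 0) ^ 2) :=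
      mul_nonneg (sq_nonneg β) hu0.le
    constructor
    · have h4 : α ^ 2 * (-(2 * esymm y)) = 0 := by linarith
      rcases mul_eq_zero.1 h4 with h | h
      · exact pow_eq_zero_iff two_ne_zero |>.1 h
      · linarith
    · have h4 : β ^ 2 * ((y 2 - y 1) ^ 2 + (y 0 - y 2) ^ 2 + (y 1 - y 0) ^ 2) = 0 := by linarith
      rcases mul_eq_zero.1 h4 with h | h
      · exact pow_eq_zero_iff two_ne_zero |>.1 h
      · linarith
  have hcomb : ∀ α β : ℝ, α • p.rep + β • L u = L (α • y + β • u) := by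
    intro α β
    simp [hy]
  have hli : LinearIndependent ℝ ![p.rep, L u] := by
    rw [LinearIndependent.pair_iff]
    intro α β h
    rw [hcomb] at h
    refine hzero α β ?_
    have h0 : α • y + β • u = 0 := L.map_eq_zero_iff.1 h
    rw [h0]
    simp [esymm]
  refine ⟨_, ⟨Submodule.span ℝ {p.rep, L u}, ?_, rfl⟩, ?_, ?_⟩
  · have hr : ({p.rep, L u} : Set (Fin 3 → ℝ)) = Set.range ![p.rep, L u] := by
      ext; simp [or_comm]
    rw [hr, finrank_span_eq_card hli, Fintype.card_fin]
  · exact Submodule.subset_span (by simp)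
  · ext r
    simp only [Set.mem_inter_iff, Set.mem_ofPred_eq, Set.mem_empty_iff_false, iff_false, not_and,
      ConicSet, Submodule.mem_span_pair]
    rintro ⟨α, β, h⟩ hr
    rw [← h, hcomb, hq] at hr
    obtain ⟨rfl, rfl⟩ := hzero α β ((mul_eq_zero.1 hr).resolve_left hK)
    exact r.rep_nonzero (by rw [← h]; simp)

section Conic

open QuadraticMap

/-- The quadratic form whose zero set is the conic through `a, b, c, d, e`. -/
def conicThrough (a b c d e : Fin 3 → ℝ) : QuadraticForm ℝ (Fin 3 → ℝ) :=
  (bracket a d e * bracket b c e) • linMulLin (bracketForm a b) (bracketForm c d)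
    - (bracket a b e * bracket c d e) • linMulLin (bracketForm a d) (bracketForm b c)

theorem conicThrough_apply (a b c d e x : Fin 3 → ℝ) :
    conicThrough a b c d e x = hexBracket a b c d e x := by
  simp [conicThrough, hexBracket, bracketForm_apply]

theorem polar_conicThrough (a b c d e : Fin 3 → ℝ) :
    polar (conicThrough a b c d e) b c
      = bracket a d e * bracket b c e * (bracket a b c * bracket b c d) := by
  have h (x) := conicThrough_apply a b c d e x
  simp only [polar, h, hexBracket]
  simp only [← bracketForm_apply, map_add]
  simp only [bracketForm_apply, bracket_self_left, bracket_self_right]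
  rw [bracket_swap_left c d b, bracket_swap_right d c b, bracket_swap_left d b c,
    bracket_swap_right b d c]
  ring

theorem sq_bracket_mul_apply {q : QuadraticForm ℝ (Fin 3 → ℝ)} {a b c : Fin 3 → ℝ}
    (ha : q a = 0) (hb : q b = 0) (hc : q c = 0) (x : Fin 3 → ℝ) :
    bracket a b c ^ 2 * q x = polar q a b * (bracket x b c * bracket a x c)
      + polar q b c * (bracket a x c * bracket a b x)
      + polar q a c * (bracket x b c * bracket a b x) := by
  have h1 : q (bracket a b c • x) = bracket a b c ^ 2 * q x := by
    rw [QuadraticMap.map_smul, smul_eq_mul, pow_two]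
  rw [← h1, bracket_smul_eq, QuadraticMap.map_add q, QuadraticMap.map_add q, polar_add_left]
  simp only [QuadraticMap.map_smul, ha, hb, hc, polar_smul_left, polar_smul_right, smul_eq_mul]
  ring

theorem conicThrough_self₁ (a b c d e : Fin 3 → ℝ) : conicThrough a b c d e a = 0 := by
  rw [conicThrough_apply]; simp only [hexBracket, bracket_self_left, zero_mul, mul_zero, sub_zero]

theorem conicThrough_self₂ (a b c d e : Fin 3 → ℝ) : conicThrough a b c d e b = 0 := by
  rw [conicThrough_apply]
  simp only [hexBracket, bracket_self_left, bracket_self_right, zero_mul, mul_zero, sub_zero]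

theorem conicThrough_self₃ (a b c d e : Fin 3 → ℝ) : conicThrough a b c d e c = 0 := by
  rw [conicThrough_apply]
  simp only [hexBracket, bracket_self_left, bracket_self_right, mul_zero, sub_zero]

theorem conicThrough_self₄ (a b c d e : Fin 3 → ℝ) : conicThrough a b c d e d = 0 := by
  rw [conicThrough_apply]
  simp only [hexBracket, bracket_self_right, zero_mul, mul_zero, sub_zero]

theorem conicThrough_self₅ (a b c d e : Fin 3 → ℝ) : conicThrough a b c d e e = 0 := by
  rw [conicThrough_apply, hexBracket]; ring

/-- Positivity of all brackets of five vectors taken in order. -/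
structure PosFive (a b c d e : Fin 3 → ℝ) : Prop where
  abc : 0 < bracket a b c
  abd : 0 < bracket a b d
  abe : 0 < bracket a b e
  acd : 0 < bracket a c d
  ace : 0 < bracket a c e
  ade : 0 < bracket a d e
  bcd : 0 < bracket b c d
  bce : 0 < bracket b c e
  bde : 0 < bracket b d e
  cde : 0 < bracket c d e

variable {q : QuadraticForm ℝ (Fin 3 → ℝ)} {a b c d e : Fin 3 → ℝ}

theorem polar_ratios (h : PosFive a b c d e) (ha : q a = 0) (hb : q b = 0) (hc : q c = 0)
    (hd : q d = 0) (he : q e = 0) :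
    polar q b c * (bracket a c d * bracket a c e * bracket b d e)
        = polar q a c * (bracket b c d * bracket b c e * bracket a d e) ∧
    polar q b c * (bracket a b d * bracket a b e * bracket c d e)
        = polar q a b * (bracket b c d * bracket b c e * bracket a d e) := by
  have h1 := sq_bracket_mul_apply ha hb hc d
  have h2 := sq_bracket_mul_apply ha hb hc e
  rw [hd, mul_zero, bracket_swap_left d b c, bracket_swap_right b d c,
    bracket_swap_right a d c] at h1
  rw [he, mul_zero, bracket_swap_left e b c, bracket_swap_right b e c,
    bracket_swap_right a e c] at h2
  have p1 := bracket_plucker a b c d e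
  have p2 := bracket_plucker b a c d e
  have p3 := bracket_plucker c a b d e
  rw [bracket_swap_left b a c, bracket_swap_left b a d, bracket_swap_left b a e] at p2
  rw [bracket_swap_left c a b, bracket_swap_right a c b, bracket_swap_left c b d,
    bracket_swap_left c a d, bracket_swap_left c b e, bracket_swap_left c a e] at p3
  have h0 := h.abc.ne'
  constructor
  · refine mul_left_cancel₀ h0 ?_
    grind
  · refine mul_left_cancel₀ h0 ?_
    grind

theorem exists_eq_mul_hexBracket (h : PosFive a b c d e) (hq : q ≠ 0) (ha : q a = 0) (hb : q b = 0)
    (hc : q c = 0) (hd : q d = 0) (he : q e = 0) :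
    ∃ r : ℝ, r ≠ 0 ∧ ∀ x, q x = r * hexBracket a b c d e x := by
  obtain ⟨h1, h2⟩ := polar_ratios h ha hb hc hd he
  have hA : 0 < polar (conicThrough a b c d e) b c := by
    rw [polar_conicThrough]
    have := h.abc; have := h.ade; have := h.bce; have := h.bcd
    positivity
  obtain ⟨h3, h4⟩ := polar_ratios h (conicThrough_self₁ a b c d e) (conicThrough_self₂ a b c d e)
    (conicThrough_self₃ a b c d e) (conicThrough_self₄ a b c d e) (conicThrough_self₅ a b c d e)
  have e1 := sq_bracket_mul_apply ha hb hc
  have e2 := sq_bracket_mul_apply (conicThrough_self₁ a b c d e) (conicThrough_self₂ a b c d e)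
    (conicThrough_self₃ a b c d e)
  simp only [conicThrough_apply] at e2
  have hm : bracket b c d * bracket b c e * bracket a d e ≠ 0 := by
    have := h.bcd; have := h.bce; have := h.ade
    positivity
  have h0 := h.abc.ne'
  generalize polar (conicThrough a b c d e) b c = A' at *
  generalize polar (conicThrough a b c d e) a c = B' at *
  generalize polar (conicThrough a b c d e) a b = C' at *
  have key : ∀ x, q x = polar q b c / A' * hexBracket a b c d e x := by
    intro x
    have hB : polar q a c * A' = polar q b c * B' := by
      refine mul_right_cancel₀ hm ?_
      linear_combination -A' * h1 + polar q b c * h3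
    have hC : polar q a b * A' = polar q b c * C' := by
      refine mul_right_cancel₀ hm ?_
      linear_combination -A' * h2 + polar q b c * h4
    rw [div_mul_eq_mul_div, eq_div_iff hA.ne']
    refine mul_left_cancel₀ (pow_ne_zero 2 h0) ?_
    linear_combination A' * e1 x - polar q b c * e2 x
      + (bracket x b c * bracket a b x) * hB + (bracket x b c * bracket a x c) * hC
  refine ⟨polar q b c / A', fun h => hq ?_, key⟩
  ext x
  rw [key, h, zero_mul, zero_apply]

theorem outsideConic_conicThrough_iff (h : PosFive a b c d e) {p : RP2}
    (hp : hexBracket a b c d e p.rep ≠ 0) :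
    OutsideConic (conicThrough a b c d e) p ↔ hexBracket a b c d e p.rep < 0 := by
  obtain ⟨h3, h4⟩ := polar_ratios h (conicThrough_self₁ a b c d e) (conicThrough_self₂ a b c d e)
    (conicThrough_self₃ a b c d e) (conicThrough_self₄ a b c d e) (conicThrough_self₅ a b c d e)
  have hm : 0 < bracket b c d * bracket b c e * bracket a d e := by
    have := h.bcd; have := h.bce; have := h.ade
    positivity
  have hA : 0 < polar (conicThrough a b c d e) b c := by
    rw [polar_conicThrough]
    have := h.abc; have := h.ade; have := h.bce; have := h.bcd
    positivity
  have hB : 0 < polar (conicThrough a b c d e) a c := by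
    refine pos_of_mul_pos_left (b := bracket b c d * bracket b c e * bracket a d e) ?_ hm.le
    rw [← h3]
    have := h.acd; have := h.ace; have := h.bde
    positivity
  have hC : 0 < polar (conicThrough a b c d e) a b := by
    refine pos_of_mul_pos_left (b := bracket b c d * bracket b c e * bracket a d e) ?_ hm.le
    rw [← h4]
    have := h.abd; have := h.abe; have := h.cde
    positivity
  set q := conicThrough a b c d e with hq
  set A := polar q b c with hA'
  set B := polar q a c with hB'
  set C := polar q a b with hC'
  have hli : LinearIndependent ℝ ![A • a, B • b, C • c] := by
    rw [linearIndependent_iff_bracket_ne_zero, bracket_smul]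
    have := h.abc
    positivity
  let L : (Fin 3 → ℝ) ≃ₗ[ℝ] (Fin 3 → ℝ) :=
    (basisOfLinearIndependentOfCardEqFinrank hli (by simp)).equivFun.symm
  have hL : ∀ y, q (L y) = (A * B * C) * esymm y := by
    intro y
    have : L y = y 0 • A • a + y 1 • B • b + y 2 • C • c := by
      simp [L, Module.Basis.equivFun_symm_apply, Fin.sum_univ_three]
    rw [this, QuadraticMap.map_add q, QuadraticMap.map_add q, polar_add_left]
    simp only [QuadraticMap.map_smul, polar_smul_left, polar_smul_right, smul_eq_mul, hq,
      conicThrough_self₁, conicThrough_self₂, conicThrough_self₃, esymm]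
    ring
  have hK : 0 < A * B * C := by positivity
  have hval : hexBracket a b c d e p.rep = (A * B * C) * esymm (L.symm p.rep) := by
    rw [← hL, L.apply_symm_apply, hq, conicThrough_apply]
  rw [hval] at hp ⊢
  constructor
  · intro ho
    by_contra! hn
    have h0 : 0 < (A * B * C) * esymm (L.symm p.rep) := lt_of_le_of_ne hn hp.symm
    exact not_outsideConic_of_esymm_pos L hL (pos_of_mul_pos_right h0 hK.le) ho
  · intro hn
    exact outsideConic_of_esymm_neg L hK.ne' hL (neg_of_mul_neg_right hn hK.le)

end Conic

/-- Positivity of all brackets of a sequence of seven vectors taken in order. -/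
def PosSeq (v : Fin 7 → Fin 3 → ℝ) : Prop :=
  ∀ i j k, i < j → j < k → 0 < bracket (v i) (v j) (v k)

/-- The six-point bracket of the vectors other than `v k`, taken in order. -/
def omitBracket (v : Fin 7 → Fin 3 → ℝ) (k : Fin 7) : ℝ :=
  hexBracket (v (k.succAbove 0)) (v (k.succAbove 1)) (v (k.succAbove 2)) (v (k.succAbove 3))
    (v (k.succAbove 4)) (v (k.succAbove 5))

section Sorting

variable {ι : Type*} [LT ι] (v : ι → Fin 3 → ℝ) (a b c d e x : Fin 3 → ℝ) {i j : ι}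

theorem bracket_sort₁ (_ : j < i) : bracket (v i) (v j) c = -bracket (v j) (v i) c :=
  bracket_swap_left ..

theorem bracket_sort₂ (_ : j < i) : bracket a (v i) (v j) = -bracket a (v j) (v i) :=
  bracket_swap_right ..

theorem hexBracket_sort₁ (_ : j < i) :
    hexBracket (v i) (v j) c d e x = -hexBracket (v j) (v i) c d e x :=
  hexBracket_swap₁ ..

theorem hexBracket_sort₂ (_ : j < i) :
    hexBracket a (v i) (v j) d e x = -hexBracket a (v j) (v i) d e x :=
  hexBracket_swap₂ ..

theorem hexBracket_sort₃ (_ : j < i) :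
    hexBracket a b (v i) (v j) e x = -hexBracket a b (v j) (v i) e x :=
  hexBracket_swap₃ ..

theorem hexBracket_sort₄ (_ : j < i) :
    hexBracket a b c (v i) (v j) x = -hexBracket a b c (v j) (v i) x :=
  hexBracket_swap₄ ..

theorem hexBracket_sort₅ (_ : j < i) :
    hexBracket a b c d (v i) (v j) = -hexBracket a b c d (v j) (v i) :=
  hexBracket_swap₅ ..

end Sorting

theorem hexBracket_succAbove (v : Fin 7 → Fin 3 → ℝ) (i : Fin 7) (m : Fin 6) :
    hexBracket (v (i.succAbove (m.succAbove 0))) (v (i.succAbove (m.succAbove 1)))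
      (v (i.succAbove (m.succAbove 2))) (v (i.succAbove (m.succAbove 3)))
      (v (i.succAbove (m.succAbove 4))) (v i)
      = if (i.val % 2 = 1 ↔ i < i.succAbove m) then omitBracket v (i.succAbove m)
        else -omitBracket v (i.succAbove m) := by
  fin_cases i <;> fin_cases m <;>
    simp [omitBracket, Fin.succAbove, hexBracket_sort₁, hexBracket_sort₂, hexBracket_sort₃,
      hexBracket_sort₄, hexBracket_sort₅, Fin.lt_def]

/-- Splittings of the seven indices into an increasing triple starting with two consecutive
indices, followed by the remaining four indices in order. -/
def tripleTable : Fin 15 → Fin 7 → Fin 7 :=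
  ![![0, 1, 2, 3, 4, 5, 6], ![0, 1, 3, 2, 4, 5, 6], ![0, 1, 4, 2, 3, 5, 6], ![0, 1, 5, 2, 3, 4, 6],
    ![0, 1, 6, 2, 3, 4, 5], ![1, 2, 3, 0, 4, 5, 6], ![1, 2, 4, 0, 3, 5, 6], ![1, 2, 5, 0, 3, 4, 6],
    ![1, 2, 6, 0, 3, 4, 5], ![2, 3, 4, 0, 1, 5, 6], ![2, 3, 5, 0, 1, 4, 6], ![2, 3, 6, 0, 1, 4, 5],
    ![3, 4, 5, 0, 1, 2, 6], ![3, 4, 6, 0, 1, 2, 5], ![4, 5, 6, 0, 1, 2, 3]]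

theorem tripleTable_injective (n : Fin 15) : Function.Injective (tripleTable n) := by
  revert n; decide

theorem PosSeq.bracket_ne_zero {v : Fin 7 → Fin 3 → ℝ} (hv : PosSeq v) {i j k : Fin 7}
    (hij : i ≠ j) (hik : i ≠ k) (hjk : j ≠ k) : bracket (v i) (v j) (v k) ≠ 0 := by
  rcases hij.lt_or_gt with h1 | h1 <;> rcases hik.lt_or_gt with h2 | h2 <;>
    rcases hjk.lt_or_gt with h3 | h3
  · exact (hv _ _ _ h1 h3).ne'
  · rw [bracket_swap_right]; exact neg_ne_zero.2 (hv _ _ _ h2 h3).ne'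
  · exact absurd (h1.trans h3) h2.asymm
  · rw [bracket_swap_right, bracket_swap_left, neg_neg]; exact (hv _ _ _ h2 h1).ne'
  · rw [bracket_swap_left]; exact neg_ne_zero.2 (hv _ _ _ h1 h2).ne'
  · exact absurd (h1.trans h2) h3.asymm
  · rw [bracket_swap_left, bracket_swap_right, neg_neg]; exact (hv _ _ _ h3 h2).ne'
  · rw [bracket_swap_left, bracket_swap_right, bracket_swap_left]
    simpa using (hv _ _ _ h3 h1).ne'

set_option maxHeartbeats 1000000 in
theorem omitBracket_relation {v : Fin 7 → Fin 3 → ℝ} (hv : PosSeq v) (n : Fin 15) :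
    ∃ P Q R : ℝ, 0 < P ∧ 0 < Q ∧ 0 < R ∧ omitBracket v (tripleTable n 0) * P
      - omitBracket v (tripleTable n 1) * Q + omitBracket v (tripleTable n 2) * R = 0 := by
  have hpos : ∀ i j k, i < j → j < k → |bracket (v i) (v j) (v k)| = bracket (v i) (v j) (v k) :=
    fun i j k hij hjk => abs_of_pos (hv i j k hij hjk)
  have hne : ∀ i j k : Fin 7, i ≠ j → i ≠ k → j ≠ k →
      0 < |bracket (v (tripleTable n i)) (v (tripleTable n j)) (v (tripleTable n k))| :=
    fun i j k hij hik hjk => abs_pos.2 <| hv.bracket_ne_zero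
      ((tripleTable_injective n).ne hij) ((tripleTable_injective n).ne hik)
      ((tripleTable_injective n).ne hjk)
  have h := hexBracket_relation (v (tripleTable n 3)) (v (tripleTable n 4)) (v (tripleTable n 5))
    (v (tripleTable n 6)) (v (tripleTable n 0)) (v (tripleTable n 1)) (v (tripleTable n 2))
  refine ⟨_, _, _,
    mul_pos (hne 3 4 0 (by decide) (by decide) (by decide))
      (hne 5 6 0 (by decide) (by decide) (by decide)),
    mul_pos (hne 3 4 1 (by decide) (by decide) (by decide))
      (hne 5 6 1 (by decide) (by decide) (by decide)),
    mul_pos (hne 3 4 2 (by decide) (by decide) (by decide))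
      (hne 5 6 2 (by decide) (by decide) (by decide)), ?_⟩
  clear hne
  fin_cases n <;>
    simp [tripleTable, omitBracket, Fin.succAbove, bracket_sort₁, bracket_sort₂, hexBracket_sort₁,
      hexBracket_sort₂, hexBracket_sort₃, hexBracket_sort₄, hexBracket_sort₅, Fin.lt_def,
      hpos] at h ⊢ <;>
    first | linear_combination h | linear_combination -h

/-- The sign sequence of the brackets `omitBracket v k`. -/
def omitSign (v : Fin 7 → Fin 3 → ℝ) (k : Fin 7) : Bool := decide (0 < omitBracket v k)

theorem omitSign_tripleTable {v : Fin 7 → Fin 3 → ℝ} (hv : PosSeq v)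
    (h0 : ∀ k, omitBracket v k ≠ 0) (n : Fin 15) :
    omitSign v (tripleTable n 0) = omitSign v (tripleTable n 1) ∨
      omitSign v (tripleTable n 1) = omitSign v (tripleTable n 2) := by
  obtain ⟨P, Q, R, hP, hQ, hR, h⟩ := omitBracket_relation hv n
  have h1 := h0 (tripleTable n 0)
  have h2 := h0 (tripleTable n 1)
  have h3 := h0 (tripleTable n 2)
  simp only [omitSign, decide_eq_decide]
  by_contra! hc
  rcases h2.lt_or_gt with h2 | h2
  · have h4 : 0 < omitBracket v (tripleTable n 0) := by
      rcases hc.1 with h | h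
      · exact h.1
      · exact absurd h.2 h2.asymm
    have h5 : 0 < omitBracket v (tripleTable n 2) := by
      rcases hc.2 with h | h
      · exact absurd h.1 h2.asymm
      · exact h.2
    nlinarith [mul_pos h4 hP, mul_pos (neg_pos.2 h2) hQ, mul_pos h5 hR]
  · have h4 : omitBracket v (tripleTable n 0) < 0 := by
      rcases hc.1 with h | h
      · exact absurd h2 h.2.not_gt
      · exact lt_of_le_of_ne h.1 h1
    have h5 : omitBracket v (tripleTable n 2) < 0 := by
      rcases hc.2 with h | h
      · exact lt_of_le_of_ne h.2 h3
      · exact absurd h2 h.1.not_gt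
    nlinarith [mul_pos (neg_pos.2 h4) hP, mul_pos h2 hQ, mul_pos (neg_pos.2 h5) hR]

/-- Whether `d_{i,j} = 1`, in terms of the sign sequence `t`. -/
def signRule (t : Fin 7 → Bool) (i j : Fin 7) : Bool :=
  if (i.val % 2 = 1 ↔ i < j) then !t j else t j

theorem signRule_spec (t : Fin 7 → Bool)
    (ht : ∀ n, t (tripleTable n 0) = t (tripleTable n 1) ∨
      t (tripleTable n 1) = t (tripleTable n 2)) :
    ((∀ i : Fin 7, signRule t i (i + 1) ≠ signRule t (i + 1) i →
      ((∀ j, j ≠ i → signRule t i j = false) ∧ (∀ j, j ≠ i + 1 → signRule t (i + 1) j = true)) ∨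
      ((∀ j, j ≠ i → signRule t i j = true) ∧ (∀ j, j ≠ i + 1 → signRule t (i + 1) j = false))) ∧
    (∃ i : Fin 7, signRule t i (i + 1) ≠ signRule t (i + 1) i ∧
      ∀ j, signRule t j (j + 1) ≠ signRule t (j + 1) j → j = i) ∧
    (∀ i : Fin 7, signRule t i (i + 1) = signRule t (i + 1) i →
      signRule t (i + 1) (i + 1 + 1) = signRule t (i + 1 + 1) (i + 1) →
      signRule t i (i + 1) ≠ signRule t (i + 1) (i + 1 + 1))) := by
  revert t
  decide +kernel

theorem bracket_rotate (a b c : Fin 3 → ℝ) : bracket b c a = bracket a b c := by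
  simp only [bracket]; ring

theorem posSeq_of_edges {w : Fin 7 → Fin 3 → ℝ}
    (h : ∀ i j k : Fin 7, j ≠ i → j ≠ i + 1 → k ≠ i → k ≠ i + 1 →
      0 < bracket (w i) (w (i + 1)) (w j) * bracket (w i) (w (i + 1)) (w k))
    (h0 : 0 < bracket (w 0) (w 1) (w 2)) : PosSeq w := by
  have ne1 : ∀ i : Fin 7, i + 1 + 1 ≠ i := by decide
  have ne2 : ∀ i : Fin 7, i + 1 + 1 ≠ i + 1 := by decide
  have ne3 : ∀ i : Fin 7, i ≠ i + 1 := by decide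
  have hn : ∀ i : Fin 7, 0 < bracket (w i) (w (i + 1)) (w (i + 1 + 1)) := by
    intro i
    induction i using Fin.induction with
    | zero => exact h0
    | succ i ih =>
      rw [← bracket_rotate] at ih
      rw [← Fin.coeSucc_eq_succ]
      have h1 := h (i.castSucc + 1) i.castSucc (i.castSucc + 1 + 1 + 1) (ne3 _) (ne1 _).symm
        (ne1 _) (ne2 _)
      exact (mul_pos_iff_of_pos_left ih).1 h1
  have hedge : ∀ i j : Fin 7, j ≠ i → j ≠ i + 1 → 0 < bracket (w i) (w (i + 1)) (w j) := by
    intro i j hj hj'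
    exact (mul_pos_iff_of_pos_left (hn i)).1 (h i _ j (ne1 i) (ne2 i) hj hj')
  have main : ∀ (k : ℕ) (hk : k < 7) (i j : Fin 7), i < j → j.val < k →
      0 < bracket (w i) (w j) (w ⟨k, hk⟩) := by
    intro k
    induction k with
    | zero => intro _ _ _ _ hj; omega
    | succ k ih =>
      intro hk i j hij hjk
      have hi1 : (i + 1).val = i.val + 1 := by rw [Fin.val_add]; simp; omega
      by_cases hj : j = i + 1
      · subst hj
        exact hedge _ _ (by rw [Ne, Fin.ext_iff]; simp; omega) (by rw [Ne, Fin.ext_iff]; simp; omega)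
      have hlt : i.val + 1 < j.val := by
        rw [Fin.ext_iff, hi1] at hj
        have : i.val < j.val := hij
        omega
      have hsucc : (⟨k + 1, hk⟩ : Fin 7) = ⟨k, by omega⟩ + 1 := by
        rw [Fin.ext_iff, Fin.val_add]; simp; omega
      have hkk : 0 < bracket (w i) (w ⟨k, by omega⟩) (w ⟨k + 1, hk⟩) := by
        rw [← bracket_rotate, hsucc]
        refine hedge _ _ ?_ ?_
        · rw [Ne, Fin.ext_iff]; simp; omega
        · rw [← hsucc, Ne, Fin.ext_iff]; simp; omega
      rcases (Nat.lt_succ_iff.1 hjk).lt_or_eq with hlt' | heq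
      · have h1 := ih (by omega) i j hij hlt'
        have hp := bracket_plucker (w i) (w (i + 1)) (w j) (w ⟨k, by omega⟩) (w ⟨k + 1, hk⟩)
        have e : ∀ l : Fin 7, i.val + 1 < l.val → 0 < bracket (w i) (w (i + 1)) (w l) := by
          intro l hl
          refine hedge _ _ ?_ ?_
          · rw [Ne, Fin.ext_iff]; omega
          · rw [Ne, Fin.ext_iff]; omega
        have e1 := e j hlt
        have e2 := e ⟨k, by omega⟩ (by simp; omega)
        have e3 := e ⟨k + 1, hk⟩ (by simp; omega)
        refine pos_of_mul_pos_right (a := bracket (w i) (w (i + 1)) (w ⟨k, by omega⟩)) ?_ e2.le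
        nlinarith [mul_pos e1 hkk, mul_pos e3 h1]
      · have : j = ⟨k, by omega⟩ := Fin.ext heq
        rw [this]
        exact hkk
  intro i j k hij hjk
  exact main k.val k.isLt i j hij hjk

theorem exists_posSeq {f : Fin 7 → RP2} (hf : SimpleCfg f) (hconv : ConsecConvexPos f) :
    ∃ (r : Fin 7 → ℝ), (∀ i, r i ≠ 0) ∧ PosSeq (fun i => r i • (f i).rep) := by
  obtain ⟨φ, ⟨-, hφ, -⟩, hedge⟩ := hconv
  have hφ1 : ∀ i, φ (chart φ (f i)) = 1 := fun i => by
    rw [chart, map_smul, smul_eq_mul, inv_mul_cancel₀ (hφ i)]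
  have hne : ∀ i j k, i ≠ j → i ≠ k → j ≠ k →
      bracket (chart φ (f i)) (chart φ (f j)) (chart φ (f k)) ≠ 0 := by
    intro i j k hij hik hjk
    have h1 := hf.2 i j k hij hik hjk
    rw [Collin, not_not, linearIndependent_iff_bracket_ne_zero] at h1
    rw [chart, chart, chart, bracket_smul]
    exact mul_ne_zero (mul_ne_zero (mul_ne_zero (inv_ne_zero (hφ i)) (inv_ne_zero (hφ j)))
      (inv_ne_zero (hφ k))) h1
  have key : ∀ i j k : Fin 7, j ≠ i → j ≠ i + 1 → k ≠ i → k ≠ i + 1 →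
      0 < bracket (chart φ (f i)) (chart φ (f (i + 1))) (chart φ (f j)) *
        bracket (chart φ (f i)) (chart φ (f (i + 1))) (chart φ (f k)) := by
    intro i j k hj hj' hk hk'
    obtain ⟨ψ, he, hlt⟩ := hedge i
    have h1 := congrArg (ψ - ψ (chart φ (f i)) • φ) (bracket_smul_eq (chart φ (f i))
      (chart φ (f (i + 1))) (chart φ (f j)) (chart φ (f k)))
    simp only [map_add, map_smul, LinearMap.sub_apply, LinearMap.smul_apply, hφ1, smul_eq_mul,
      mul_one, ← he, sub_self, mul_zero, zero_add] at h1
    have hj1 := sub_neg.2 (hlt j hj hj')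
    have hk1 := sub_neg.2 (hlt k hk hk')
    have hb := hne i (i + 1) j (by clear * -; decide +revert) hj.symm hj'.symm
    refine pos_of_mul_neg_left (b := ψ (chart φ (f j)) - ψ (chart φ (f i))) ?_ hj1.le
    rw [mul_assoc, ← h1, ← mul_assoc]
    exact mul_neg_of_pos_of_neg (mul_self_pos.2 hb) hk1
  rcases (hne 0 1 2 (by decide) (by decide) (by decide)).lt_or_gt with h | h
  · refine ⟨fun i => -(φ (f i).rep)⁻¹, fun i => neg_ne_zero.2 (inv_ne_zero (hφ i)),
      posSeq_of_edges ?_ ?_⟩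
    · intro i j k hj hj' hk hk'
      simp only [neg_smul, bracket_neg, neg_mul_neg]
      exact key i j k hj hj' hk hk'
    · simp only [neg_smul, bracket_neg]
      exact neg_pos.2 h
  · exact ⟨fun i => (φ (f i).rep)⁻¹, fun i => inv_ne_zero (hφ i), posSeq_of_edges key h⟩

theorem PosSeq.posFive {v : Fin 7 → Fin 3 → ℝ} (hv : PosSeq v) {g : Fin 5 → Fin 7}
    (hg : StrictMono g) : PosFive (v (g 0)) (v (g 1)) (v (g 2)) (v (g 3)) (v (g 4)) := by
  constructor <;> exact hv _ _ _ (hg (by decide)) (hg (by decide))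

theorem quadraticForm_smul_eq_zero_iff {q : QuadraticForm ℝ (Fin 3 → ℝ)} {r : ℝ} (hr : r ≠ 0)
    (x : Fin 3 → ℝ) : q (r • x) = 0 ↔ q x = 0 := by
  rw [QuadraticMap.map_smul, smul_eq_mul]
  simp [hr]

theorem conicThrough_ne_zero {a b c d e : Fin 3 → ℝ} (h : PosFive a b c d e) :
    conicThrough a b c d e ≠ 0 := by
  intro h0
  have hA := polar_conicThrough a b c d e
  rw [h0] at hA
  have := h.abc; have := h.ade; have := h.bce; have := h.bcd
  have h1 : 0 < bracket a d e * bracket b c e * (bracket a b c * bracket b c d) := by positivity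
  simp [QuadraticMap.polar] at hA
  grind

theorem omitBracket_ne_zero {f : Fin 7 → RP2} (hf : TypicalCfg f) {r : Fin 7 → ℝ}
    (hr : ∀ i, r i ≠ 0) (hv : PosSeq fun i => r i • (f i).rep) (k : Fin 7) :
    omitBracket (fun i => r i • (f i).rep) k ≠ 0 := by
  intro h
  have hg : StrictMono fun n : Fin 5 => k.succAbove n.castSucc :=
    (Fin.strictMono_succAbove k).comp Fin.strictMono_castSucc
  refine hf.2 k.succAbove Fin.succAbove_right_injective
    ⟨_, conicThrough_ne_zero (hv.posFive hg), ?_⟩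
  rintro _ ⟨n, rfl⟩
  rw [Function.comp_apply, ← quadraticForm_smul_eq_zero_iff (hr (k.succAbove n))]
  fin_cases n
  · exact conicThrough_self₁ ..
  · exact conicThrough_self₂ ..
  · exact conicThrough_self₃ ..
  · exact conicThrough_self₄ ..
  · exact conicThrough_self₅ ..
  · rw [conicThrough_apply]; exact h

theorem outAll_succAbove_iff {f : Fin 7 → RP2} {r : Fin 7 → ℝ} (hr : ∀ i, r i ≠ 0)
    (hv : PosSeq fun i => r i • (f i).rep) (i : Fin 7) (m : Fin 6) {a b c d e x : Fin 3 → ℝ}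
    (ha : a = r (i.succAbove (m.succAbove 0)) • (f (i.succAbove (m.succAbove 0))).rep)
    (hb : b = r (i.succAbove (m.succAbove 1)) • (f (i.succAbove (m.succAbove 1))).rep)
    (hc : c = r (i.succAbove (m.succAbove 2)) • (f (i.succAbove (m.succAbove 2))).rep)
    (hd : d = r (i.succAbove (m.succAbove 3)) • (f (i.succAbove (m.succAbove 3))).rep)
    (he : e = r (i.succAbove (m.succAbove 4)) • (f (i.succAbove (m.succAbove 4))).rep)
    (hx : x = r i • (f i).rep) (hne : hexBracket a b c d e x ≠ 0) :
    OutAll f i (i.succAbove m) ↔ hexBracket a b c d e x < 0 := by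
  have hg : StrictMono fun n : Fin 5 => i.succAbove (m.succAbove n) :=
    (Fin.strictMono_succAbove i).comp (Fin.strictMono_succAbove m)
  have hpos : PosFive a b c d e := by subst ha hb hc hd he; exact hv.posFive hg
  have hval : hexBracket a b c d e x = r i ^ 2 * hexBracket a b c d e (f i).rep := by
    rw [← conicThrough_apply, ← conicThrough_apply, hx, QuadraticMap.map_smul, smul_eq_mul,
      pow_two]
  have hri : 0 < r i ^ 2 := by have := hr i; positivity
  rw [hval] at hne ⊢
  have hiff := outsideConic_conicThrough_iff (p := f i) hpos (right_ne_zero_of_mul hne)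
  have hmul (t : ℝ) : r i ^ 2 * t < 0 ↔ t < 0 :=
    ⟨fun h => neg_of_mul_neg_right h hri.le, fun h => mul_neg_of_pos_of_neg hri h⟩
  rw [hmul, ← hiff]
  constructor
  · refine fun h => h _ (conicThrough_ne_zero hpos) fun k hk hk' => ?_
    obtain ⟨k, rfl⟩ := Fin.exists_succAbove_eq hk
    obtain ⟨n, rfl⟩ := Fin.exists_succAbove_eq (fun h => hk' (congrArg _ h))
    rw [← quadraticForm_smul_eq_zero_iff (hr (i.succAbove (m.succAbove n)))]
    fin_cases n
    · exact ha ▸ conicThrough_self₁ ..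
    · exact hb ▸ conicThrough_self₂ ..
    · exact hc ▸ conicThrough_self₃ ..
    · exact hd ▸ conicThrough_self₄ ..
    · exact he ▸ conicThrough_self₅ ..
  · intro h q hq hvan
    have hvan' : ∀ n, q (r (i.succAbove (m.succAbove n)) • (f (i.succAbove (m.succAbove n))).rep) = 0 :=
      fun n => (quadraticForm_smul_eq_zero_iff (hr _) _).2 (hvan _ (Fin.succAbove_ne _ _)
        fun h => Fin.succAbove_ne _ _ (Fin.succAbove_right_injective h))
    obtain ⟨s, hs, hqs⟩ := exists_eq_mul_hexBracket hpos hq (ha ▸ hvan' 0) (hb ▸ hvan' 1)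
      (hc ▸ hvan' 2) (hd ▸ hvan' 3) (he ▸ hvan' 4)
    have hset : ConicSet q = ConicSet (conicThrough a b c d e) := by
      ext p
      simp [ConicSet, hqs, hs, conicThrough_apply]
    simpa only [OutsideConic, hset] using h

theorem dIdx_eq {f : Fin 7 → RP2} (hf : TypicalCfg f) {r : Fin 7 → ℝ}
    (hr : ∀ i, r i ≠ 0) (hv : PosSeq fun i => r i • (f i).rep) {i j : Fin 7} (hij : j ≠ i) :
    dIdx f i j = (signRule (omitSign fun i => r i • (f i).rep) i j).toNat := by
  obtain ⟨m, rfl⟩ := Fin.exists_succAbove_eq hij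
  have h0 := omitBracket_ne_zero hf hr hv (i.succAbove m)
  have hs := hexBracket_succAbove (fun i => r i • (f i).rep) i m
  have hiff := outAll_succAbove_iff hr hv i m rfl rfl rfl rfl rfl rfl
    (by rw [hs]; split_ifs <;> simpa using h0)
  rw [hs] at hiff
  rw [dIdx, hiff, signRule, omitSign]
  split_ifs with h1 h2 h2
  · simp [h2.not_gt]
  · simp [lt_of_le_of_ne (not_lt.1 h2) h0.symm]
  · simp [neg_lt_zero.1 h2]
  · simp [not_lt.2 (show omitBracket (fun i => r i • (f i).rep) (i.succAbove m) ≤ 0 by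
      simpa using h2)]

/-- For a heptagonal typical 7-configuration numbered consecutively along the convex
position: (i) every special edge joins a point of dominance index 0 to a point of dominance
index 6; (ii) there is exactly one special edge; (iii) non-special edges alternate between
internal and external around the heptagon. -/
theorem special_edge_properties (f : Fin 7 → RP2)
    (hf : TypicalCfg f) (hconv : ConsecConvexPos f) :
    (∀ i : Fin 7, SpecialEdge f i →
      (domIdx f i = 0 ∧ domIdx f (i + 1) = 6) ∨ (domIdx f i = 6 ∧ domIdx f (i + 1) = 0)) ∧
    (∃! i : Fin 7, SpecialEdge f i) ∧
    (∀ i : Fin 7, ¬ SpecialEdge f i → ¬ SpecialEdge f (i + 1) →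
      (InternalEdge f i ∧ ExternalEdge f (i + 1)) ∨
      (ExternalEdge f i ∧ InternalEdge f (i + 1))) := by
  obtain ⟨r, hr, hv⟩ := exists_posSeq hf.1 hconv
  have hd : ∀ i j, j ≠ i → dIdx f i j = (signRule (omitSign fun i => r i • (f i).rep) i j).toNat :=
    fun i j hij => dIdx_eq hf hr hv hij
  obtain ⟨h1, h2, h3⟩ := signRule_spec _ (omitSign_tripleTable hv (omitBracket_ne_zero hf hr hv))
  generalize omitSign (fun i => r i • (f i).rep) = t at *
  have hsucc : ∀ i : Fin 7, i + 1 ≠ i := by decide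
  have hspec : ∀ i, SpecialEdge f i ↔ signRule t i (i + 1) ≠ signRule t (i + 1) i := by
    intro i
    rw [SpecialEdge, InternalEdge, ExternalEdge, hd _ _ (hsucc i), hd _ _ (hsucc i).symm]
    cases signRule t i (i + 1) <;> cases signRule t (i + 1) i <;> simp
  have hdom : ∀ (i : Fin 7) (b : Bool), (∀ j, j ≠ i → signRule t i j = b) →
      domIdx f i = 6 * b.toNat := by
    intro i b h
    rw [domIdx, Finset.sum_congr rfl (g := fun _ => b.toNat)]
    · simp
    · intro j hj
      rw [hd i j (Finset.ne_of_mem_erase hj), h j (Finset.ne_of_mem_erase hj)]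
  refine ⟨fun i hi => ?_, ?_, fun i hi hi' => ?_⟩
  · rcases h1 i ((hspec i).1 hi) with ⟨ha, hb⟩ | ⟨ha, hb⟩
    · exact Or.inl ⟨hdom i _ ha, hdom _ _ hb⟩
    · exact Or.inr ⟨hdom i _ ha, hdom _ _ hb⟩
  · obtain ⟨i, hi, hu⟩ := h2
    exact ⟨i, (hspec i).2 hi, fun j hj => hu j ((hspec j).1 hj)⟩
  · rw [hspec, not_not] at hi hi'
    have h := h3 i hi hi'
    simp only [InternalEdge, ExternalEdge, hd _ _ (hsucc i), hd _ _ (hsucc i).symm,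
      hd _ _ (hsucc (i + 1)), hd _ _ (hsucc (i + 1)).symm, ← hi, ← hi']
    revert h
    cases signRule t i (i + 1) <;> cases signRule t (i + 1) (i + 1 + 1) <;> simp

end
end
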